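/- arXiv:1708.02065 — 9 statements merged into one kernel-verified Lean document; each statement's English description precedes it below -/
import Mathlib

section
/- Let Ω be a nonempty open subset of ℝⁿ × ℝ, let F : Ω → ℝ be differentiable at every point of Ω, suppose the partial derivative ∂F/∂y(x,y) is nonzero for every (x,y) in Ω, and let (a,b) ∈ Ω with F(a,b) = 0. Then there exist an open set X ⊆ ℝⁿ containing a and an open set Y ⊆ ℝ containing b with X × Y ⊆ Ω, and a unique function g : X → Y satisfying F(x, g(x)) = 0 for all x in X; moreover, g(a) = b. -/
/-- A real function that is differentiable with nonvanishing derivative on a convex set is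
injective there. -/
theorem injOn_of_hasDerivAt_ne_zero {f f' : ℝ → ℝ} {s : Set ℝ} (hs : s.OrdConnected)
    (hf : ∀ y ∈ s, HasDerivAt f (f' y) y) (hf' : ∀ y ∈ s, f' y ≠ 0) : Set.InjOn f s := by
  have key : ∀ u ∈ s, ∀ v ∈ s, u < v → f u ≠ f v := by
    intro u hu v hv huv h
    have hsub : Set.Icc u v ⊆ s := hs.out hu hv
    obtain ⟨c, hc, hc0⟩ := exists_hasDerivAt_eq_zero huv
      (fun y hy => (hf y (hsub hy)).continuousAt.continuousWithinAt) h
      (fun y hy => hf y (hsub (Set.Ioo_subset_Icc_self hy)))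
    exact hf' c (hsub (Set.Ioo_subset_Icc_self hc)) hc0
  intro u hu v hv h
  rcases lt_trichotomy u v with huv | huv | huv
  · exact absurd h (key u hu v hv huv)
  · exact huv
  · exact absurd h.symm (key v hv u hu huv)

/-- A continuous injective real function on an interval takes values of opposite signs at the
endpoints if it vanishes at an interior point. -/
theorem mul_neg_of_continuousOn_of_injOn {f : ℝ → ℝ} {u v c : ℝ} (hc : c ∈ Set.Ioo u v)
    (hf : ContinuousOn f (Set.Icc u v)) (hinj : Set.InjOn f (Set.Icc u v)) (h0 : f c = 0) :
    f u * f v < 0 := by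
  have huv : u ≤ v := (hc.1.trans hc.2).le
  have hu : u ∈ Set.Icc u v := Set.left_mem_Icc.2 huv
  have hv : v ∈ Set.Icc u v := Set.right_mem_Icc.2 huv
  have hc' := Set.Ioo_subset_Icc_self hc
  rcases hf.strictMonoOn_of_injOn_Icc' huv hinj with h | h
  · exact mul_neg_of_neg_of_pos (h0 ▸ h hu hc' hc.1) (h0 ▸ h hc' hv hc.2)
  · exact mul_neg_of_pos_of_neg (h0 ▸ h hu hc' hc.1) (h0 ▸ h hc' hv hc.2)

/-- A continuous real function with values of opposite signs at the endpoints of an interval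
vanishes at an interior point. -/
theorem exists_mem_Ioo_eq_zero_of_mul_neg {f : ℝ → ℝ} {u v : ℝ} (huv : u ≤ v)
    (hf : ContinuousOn f (Set.Icc u v)) (h : f u * f v < 0) : ∃ y ∈ Set.Ioo u v, f y = 0 := by
  rcases mul_neg_iff.1 h with ⟨h1, h2⟩ | ⟨h1, h2⟩
  · exact intermediate_value_Ioo' huv hf ⟨h2, h1⟩
  · exact intermediate_value_Ioo huv hf ⟨h1, h2⟩

/-- **Implicit function theorem, one scalar equation (existence and uniqueness).**
Let `Ω ⊆ ℝⁿ × ℝ` be nonempty and open, let `F : Ω → ℝ` be (Fréchet) differentiable at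
every point of `Ω`, with the partial derivative `∂F/∂y = fderiv ℝ F (x,y) (0,1)` nowhere
vanishing on `Ω`, and let `(a,b) ∈ Ω` satisfy `F(a,b) = 0`. Then there are open sets
`X ∋ a` and `Y ∋ b` with `X × Y ⊆ Ω` and a unique function `g : X → Y` with
`F(x, g x) = 0` for all `x ∈ X`; moreover `g a = b`. -/
theorem implicit_function_theorem_scalar_existence_uniqueness {n : ℕ}
    (Ω : Set (EuclideanSpace ℝ (Fin n) × ℝ)) (hΩ : IsOpen Ω) (hne : Ω.Nonempty)
    (F : EuclideanSpace ℝ (Fin n) × ℝ → ℝ)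
    (hF : ∀ p ∈ Ω, DifferentiableAt ℝ F p)
    (hFy : ∀ p ∈ Ω, fderiv ℝ F p ((0 : EuclideanSpace ℝ (Fin n)), (1 : ℝ)) ≠ 0)
    (a : EuclideanSpace ℝ (Fin n)) (b : ℝ)
    (hab : (a, b) ∈ Ω) (hFab : F (a, b) = 0) :
    ∃ (X : Set (EuclideanSpace ℝ (Fin n))) (Y : Set ℝ),
      IsOpen X ∧ IsOpen Y ∧ a ∈ X ∧ b ∈ Y ∧ X ×ˢ Y ⊆ Ω ∧
      ∃ g : EuclideanSpace ℝ (Fin n) → ℝ,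
        (∀ x ∈ X, g x ∈ Y ∧ F (x, g x) = 0) ∧ g a = b ∧
        ∀ h : EuclideanSpace ℝ (Fin n) → ℝ,
          (∀ x ∈ X, h x ∈ Y ∧ F (x, h x) = 0) → ∀ x ∈ X, h x = g x := by
  obtain ⟨r, hr, hball⟩ := Metric.isOpen_iff.1 hΩ (a, b) hab
  have hs : 0 < r / 2 := half_pos hr
  have hmem : ∀ x ∈ Metric.ball a r, ∀ y ∈ Set.Icc (b - r / 2) (b + r / 2), (x, y) ∈ Ω := by
    intro x hx y hy
    apply hball
    rw [← ball_prod_same]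
    refine ⟨hx, ?_⟩
    rw [Real.ball_eq_Ioo]
    exact ⟨by linarith [hy.1], by linarith [hy.2]⟩
  have hderiv : ∀ x ∈ Metric.ball a r, ∀ y ∈ Set.Icc (b - r / 2) (b + r / 2),
      HasDerivAt (fun t => F (x, t)) (fderiv ℝ F (x, y) (0, 1)) y := fun x hx y hy =>
    (hF _ (hmem x hx y hy)).hasFDerivAt.comp_hasDerivAt y
      ((hasDerivAt_const y x).prodMk (hasDerivAt_id y))
  have hcont : ∀ x ∈ Metric.ball a r,
      ContinuousOn (fun t => F (x, t)) (Set.Icc (b - r / 2) (b + r / 2)) := fun x hx y hy =>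
    (hderiv x hx y hy).continuousAt.continuousWithinAt
  have hinj : ∀ x ∈ Metric.ball a r,
      Set.InjOn (fun t => F (x, t)) (Set.Icc (b - r / 2) (b + r / 2)) := fun x hx =>
    injOn_of_hasDerivAt_ne_zero Set.ordConnected_Icc (hderiv x hx)
      (fun y hy => hFy _ (hmem x hx y hy))
  have ha : a ∈ Metric.ball a r := Metric.mem_ball_self hr
  have hb : b ∈ Set.Ioo (b - r / 2) (b + r / 2) := ⟨by linarith, by linarith⟩
  have hle : b - r / 2 ≤ b + r / 2 := by linarith
  have hsign : F (a, b - r / 2) * F (a, b + r / 2) < 0 :=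
    mul_neg_of_continuousOn_of_injOn hb (hcont a ha) (hinj a ha) hFab
  have hslice : ∀ y ∈ Set.Icc (b - r / 2) (b + r / 2), ContinuousAt (fun x => F (x, y)) a :=
    fun y hy => ContinuousAt.comp (f := fun x => (x, y)) (hF _ (hmem a ha y hy)).continuousAt
      (by fun_prop)
  have hev := ((hslice _ (Set.left_mem_Icc.2 hle)).mul
    (hslice _ (Set.right_mem_Icc.2 hle))).eventually_lt_const hsign
  obtain ⟨δ, hδ, hδball⟩ :=
    Metric.eventually_nhds_iff_ball.1 (hev.and (Metric.ball_mem_nhds a hr))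
  have hex : ∀ x ∈ Metric.ball a δ, ∃ y ∈ Set.Ioo (b - r / 2) (b + r / 2), F (x, y) = 0 :=
    fun x hx => exists_mem_Ioo_eq_zero_of_mul_neg hle (hcont x (hδball x hx).2) (hδball x hx).1
  have huniq : ∀ x ∈ Metric.ball a δ, ∀ y ∈ Set.Ioo (b - r / 2) (b + r / 2),
      ∀ z ∈ Set.Ioo (b - r / 2) (b + r / 2), F (x, y) = 0 → F (x, z) = 0 → y = z :=
    fun x hx y hy z hz hy0 hz0 => hinj x (hδball x hx).2 (Set.Ioo_subset_Icc_self hy)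
      (Set.Ioo_subset_Icc_self hz) (hy0.trans hz0.symm)
  choose! g hgY hg0 using hex
  have haδ : a ∈ Metric.ball a δ := Metric.mem_ball_self hδ
  exact ⟨Metric.ball a δ, Set.Ioo (b - r / 2) (b + r / 2), Metric.isOpen_ball, isOpen_Ioo, haδ, hb,
    fun p hp => hmem p.1 (hδball p.1 hp.1).2 p.2 (Set.Ioo_subset_Icc_self hp.2), g,
    fun x hx => ⟨hgY x hx, hg0 x hx⟩, huniq a haδ _ (hgY a haδ) b hb (hg0 a haδ) hFab,
    fun h hh x hx => huniq x hx _ (hh x hx).1 _ (hgY x hx) (hh x hx).2 (hg0 x hx)⟩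
end

section
/- Let Ω be a nonempty open subset of ℝⁿ × ℝ, let F : Ω → ℝ be differentiable at every point of Ω, suppose ∂F/∂y(x,y) ≠ 0 for every (x,y) in Ω, let (a,b) ∈ Ω with F(a,b) = 0, and let X × Y ⊆ Ω be an open product set containing (a,b) on which g : X → Y is the unique function with F(x, g(x)) = 0 for all x ∈ X and g(a) = b. Then g is differentiable at every point of X and, for each j = 1, …, n and every x in X, ∂g/∂xⱼ(x) = − (∂F/∂xⱼ(x, g(x))) / (∂F/∂y(x, g(x))). -/
open Filter Topology Asymptotics

/-- Near a zero of a scalar equation at which the partial derivative in the scalar variable does not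
vanish, a function whose value is the only zero in the scalar variable is continuous. -/
theorem continuousAt_of_unique_zero {E : Type*} [TopologicalSpace E] {F : E × ℝ → ℝ} {g : E → ℝ}
    {x₀ : E} {c : ℝ} {Y : Set ℝ} (hY : Y ∈ 𝓝 (g x₀)) (h₀ : F (x₀, g x₀) = 0)
    (hc : HasDerivAt (fun y => F (x₀, y)) c (g x₀)) (hc₀ : c ≠ 0)
    (hF : ∀ y ∈ Y, ContinuousAt F (x₀, y))
    (hFy : ∀ᶠ x in 𝓝 x₀, ContinuousOn (fun y => F (x, y)) Y)
    (huniq : ∀ᶠ x in 𝓝 x₀, ∀ y ∈ Y, F (x, y) = 0 → y = g x) :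
    ContinuousAt g x₀ := by
  refine Metric.tendsto_nhds.2 fun ε hε => ?_
  obtain ⟨δ, hδ, hδY⟩ := Metric.mem_nhds_iff.1 (inter_mem hY (Metric.ball_mem_nhds (g x₀) hε))
  have hball := Metric.ball_mem_nhds (g x₀) hδ
  obtain ⟨y₁, hy₁, hneg⟩ : ∃ y ∈ Metric.ball (g x₀) δ, F (x₀, y) < 0 := by
    by_contra! h
    refine hc₀ (IsLocalMin.hasDerivAt_eq_zero ?_ hc)
    filter_upwards [hball] with y hy using h₀.trans_le (h y hy)
  obtain ⟨y₂, hy₂, hpos⟩ : ∃ y ∈ Metric.ball (g x₀) δ, 0 < F (x₀, y) := by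
    by_contra! h
    refine hc₀ (IsLocalMax.hasDerivAt_eq_zero ?_ hc)
    filter_upwards [hball] with y hy using (h y hy).trans_eq h₀.symm
  have hslice : ∀ y ∈ Metric.ball (g x₀) δ, ContinuousAt (fun x => F (x, y)) x₀ := fun y hy =>
    ContinuousAt.comp (f := fun x => (x, y)) (hF y (hδY hy).1) (by fun_prop)
  filter_upwards [hFy, huniq, (hslice y₁ hy₁).eventually_lt_const hneg,
    (hslice y₂ hy₂).eventually_const_lt hpos] with x hcont hx hx₁ hx₂
  have hsub : Set.uIcc y₁ y₂ ⊆ Metric.ball (g x₀) δ := by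
    rw [← segment_eq_uIcc]
    exact (convex_ball _ _).segment_subset hy₁ hy₂
  obtain ⟨y, hy, hy₀⟩ := intermediate_value_uIcc
    (hcont.mono fun y hy => (hδY (hsub hy)).1) (Set.mem_uIcc_of_le hx₁.le hx₂.le)
  rw [← hx y (hδY (hsub hy)).1 hy₀]
  exact (hδY (hsub hy)).2

/-- A continuous function defined implicitly by a scalar equation `F (x, g x) = 0` is differentiable
at any point where `F` is differentiable with nonzero partial derivative in the scalar variable. -/
theorem hasFDerivAt_of_eventually_zero {E : Type*} [NormedAddCommGroup E] [NormedSpace ℝ E]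
    {F : E × ℝ → ℝ} {F' : E × ℝ →L[ℝ] ℝ} {g : E → ℝ} {x₀ : E} (hg : ContinuousAt g x₀)
    (hF : HasFDerivAt F F' (x₀, g x₀)) (hF' : F' (0, 1) ≠ 0)
    (h₀ : ∀ᶠ x in 𝓝 x₀, F (x, g x) = 0) :
    HasFDerivAt g (-(F' (0, 1))⁻¹ • F'.comp (ContinuousLinearMap.inl ℝ E ℝ)) x₀ := by
  set c := F' (0, 1) with hc
  set L := -c⁻¹ • F'.comp (ContinuousLinearMap.inl ℝ E ℝ) with hL
  set Δ : E → ℝ := fun x => g x - g x₀ - L (x - x₀) with hΔ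
  set φ : E → E × ℝ := fun x => (x, g x) - (x₀, g x₀) with hφ
  have hlin : ∀ x, F' (φ x) = c * Δ x := fun x => by
    have hsplit : φ x = (x - x₀, 0) + (g x - g x₀) • ((0 : E), (1 : ℝ)) := by simp [hφ]
    rw [hsplit, map_add, map_smul]
    simp only [hΔ, hL, smul_apply, ContinuousLinearMap.comp_apply,
      ContinuousLinearMap.inl_apply, smul_eq_mul, ← hc]
    field_simp
    ring
  have htend : Tendsto (fun x => (x, g x)) (𝓝 x₀) (𝓝 (x₀, g x₀)) := continuousAt_id.prodMk hg
  have hΔo : Δ =o[𝓝 x₀] φ := by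
    have h := hF.isLittleO.comp_tendsto htend
    have h' : (fun x => c * Δ x) =o[𝓝 x₀] φ := by
      refine h.neg_left.congr' ?_ EventuallyEq.rfl
      filter_upwards [h₀] with x hx
      simp only [Function.comp_apply, hx, h₀.self_of_nhds, ← hlin, hφ]
      ring
    exact (isLittleO_const_mul_left_iff hF').1 h'
  have hφO : φ =O[𝓝 x₀] fun x => x - x₀ := by
    have hΔ' : (fun x => -((0 : E), Δ x)) =o[𝓝 x₀] φ :=
      (((ContinuousLinearMap.inr ℝ E ℝ).isBigO_comp Δ (𝓝 x₀)).trans_isLittleO hΔo).neg_left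
    refine hΔ'.right_isBigO_add.trans ?_
    refine (((ContinuousLinearMap.id ℝ E).prod L).isBigO_comp (fun x => x - x₀) (𝓝 x₀)).congr_left
      fun x => ?_
    simp [hφ, hΔ]
  exact .of_isLittleO (hΔo.trans_isBigO hφO)

/-- **Implicit function theorem, one scalar equation (differentiability and derivative
formula).** With `Ω ⊆ ℝⁿ × ℝ` nonempty open, `F` differentiable on `Ω`, `∂F/∂y` nowhere
vanishing on `Ω`, `(a,b) ∈ Ω`, `F(a,b) = 0`, and `g : X → Y` the unique function on an
open product set `X × Y ⊆ Ω` containing `(a,b)` with `F(x, g x) = 0` on `X` and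
`g a = b`, the function `g` is differentiable at every point of `X` and
`∂g/∂xⱼ(x) = - (∂F/∂xⱼ(x, g x)) / (∂F/∂y(x, g x))` for every `x ∈ X` and `j = 1,…,n`. -/
theorem implicit_function_theorem_scalar_derivative {n : ℕ}
    (Ω : Set (EuclideanSpace ℝ (Fin n) × ℝ)) (hΩ : IsOpen Ω) (hne : Ω.Nonempty)
    (F : EuclideanSpace ℝ (Fin n) × ℝ → ℝ)
    (hF : ∀ p ∈ Ω, DifferentiableAt ℝ F p)
    (hFy : ∀ p ∈ Ω, fderiv ℝ F p ((0 : EuclideanSpace ℝ (Fin n)), (1 : ℝ)) ≠ 0)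
    (a : EuclideanSpace ℝ (Fin n)) (b : ℝ)
    (hab : (a, b) ∈ Ω) (hFab : F (a, b) = 0)
    (X : Set (EuclideanSpace ℝ (Fin n))) (Y : Set ℝ)
    (hX : IsOpen X) (hY : IsOpen Y) (haX : a ∈ X) (hbY : b ∈ Y) (hXY : X ×ˢ Y ⊆ Ω)
    (g : EuclideanSpace ℝ (Fin n) → ℝ)
    (hg : ∀ x ∈ X, g x ∈ Y ∧ F (x, g x) = 0) (hga : g a = b)
    (huniq : ∀ h : EuclideanSpace ℝ (Fin n) → ℝ,
      (∀ x ∈ X, h x ∈ Y ∧ F (x, h x) = 0) → ∀ x ∈ X, h x = g x) :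
    ∀ x ∈ X, DifferentiableAt ℝ g x ∧
      ∀ j : Fin n,
        fderiv ℝ g x (EuclideanSpace.single j 1) =
          - (fderiv ℝ F (x, g x) (EuclideanSpace.single j 1, (0 : ℝ))) /
            (fderiv ℝ F (x, g x) ((0 : EuclideanSpace ℝ (Fin n)), (1 : ℝ))) := by
  intro x₀ hx₀
  have hmem : ∀ x ∈ X, ∀ y ∈ Y, (x, y) ∈ Ω := fun x hx y hy => hXY ⟨hx, hy⟩
  have hzero : ∀ x ∈ X, ∀ y ∈ Y, F (x, y) = 0 → y = g x := fun x hx y hy hxy => by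
    classical
    refine (Function.update_self x y g).symm.trans
      (huniq (Function.update g x y) (fun z hz => ?_) x hx)
    rcases eq_or_ne z x with rfl | hzx
    · simpa using ⟨hy, hxy⟩
    · simpa [hzx] using hg z hz
  have hXn := hX.mem_nhds hx₀
  have hp := hmem x₀ hx₀ (g x₀) (hg x₀ hx₀).1
  have hFp := (hF _ hp).hasFDerivAt
  have hcont : ContinuousAt g x₀ := by
    refine continuousAt_of_unique_zero (hY.mem_nhds (hg x₀ hx₀).1) (hg x₀ hx₀).2
      (hFp.comp_hasDerivAt (g x₀) ((hasDerivAt_const _ x₀).prodMk (hasDerivAt_id _))) (hFy _ hp)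
      (fun y hy => (hF _ (hmem x₀ hx₀ y hy)).continuousAt) ?_ ?_
    · filter_upwards [hXn] with x hx y hy
      exact (ContinuousAt.comp (f := fun y => (x, y)) (hF _ (hmem x hx y hy)).continuousAt
        (by fun_prop)).continuousWithinAt
    · filter_upwards [hXn] with x hx using hzero x hx
  have hderiv := hasFDerivAt_of_eventually_zero hcont hFp (hFy _ hp)
    (by filter_upwards [hXn] with x hx using (hg x hx).2)
  refine ⟨hderiv.differentiableAt, fun j => ?_⟩
  rw [hderiv.fderiv]
  simp [div_eq_inv_mul]
end

section
/- Let Ω be a non-degenerate open ball in ℝⁿ × ℝᵐ centered at (a,b), let F = (F₁,…,Fₘ) : Ω → ℝᵐ be differentiable at every point of Ω with F(a,b) = 0, and suppose that for every k = 1,…,m and every (x,y) ∈ Ω the k-th order leading principal minor of the m×m matrix ∂F/∂y(x,y) = (∂Fᵢ/∂yⱼ(x,y)) is nonzero. Then there exist an open set X ⊆ ℝⁿ containing a and an open set Y ⊆ ℝᵐ containing b with X × Y ⊆ Ω, and a differentiable function g : X → Y satisfying F(x, g(x)) = 0 for all x in X and g(a) = b. -/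
open Set Filter Topology

/-- An implicit function which is merely continuous at a point is differentiable there, provided
that the equation is differentiable with nonzero partial derivative in the unknown. -/
theorem differentiableAt_of_implicit_scalar {E : Type*} [NormedAddCommGroup E] [NormedSpace ℝ E]
    {h : E × ℝ → ℝ} {φ : E → ℝ} {x : E} (hφ : ContinuousAt φ x)
    (hd : DifferentiableAt ℝ h (x, φ x)) (hne : fderiv ℝ h (x, φ x) (0, 1) ≠ 0)
    (hz : ∀ᶠ z in 𝓝 x, h (z, φ z) = 0) : DifferentiableAt ℝ φ x := by
  set L := fderiv ℝ h (x, φ x)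
  have hf : HasFDerivAt (fun p : E × ℝ => (p.1, h p))
      ((ContinuousLinearMap.fst ℝ E ℝ).prod L) (x, φ x) :=
    hasFDerivAt_fst.prodMk hd.hasFDerivAt
  have hi : HasFDerivAt (fun z : E => (z, (0 : ℝ)))
      ((ContinuousLinearMap.id ℝ E).prod (0 : E →L[ℝ] ℝ)) x :=
    (hasFDerivAt_id x).prodMk (hasFDerivAt_const 0 x)
  let M : E × ℝ →L[ℝ] E × ℝ := (ContinuousLinearMap.fst ℝ E ℝ).prod
    ((L (0, 1))⁻¹ • (ContinuousLinearMap.snd ℝ E ℝ -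
      (L.comp (ContinuousLinearMap.inl ℝ E ℝ)).comp (ContinuousLinearMap.fst ℝ E ℝ)))
  have hM : Function.LeftInverse M ((ContinuousLinearMap.fst ℝ E ℝ).prod L) := by
    rintro ⟨u, t⟩
    have hsplit : L (u, t) = L (u, 0) + t * L (0, 1) := by
      rw [← smul_eq_mul, ← map_smul, ← map_add]
      simp
    have : (L (0, 1))⁻¹ * (L (u, t) - L (u, 0)) = t := by
      rw [hsplit]
      field_simp
      ring
    simpa [M] using this
  have key := HasFDerivAt.of_comp_of_leftInverse (g := fun z => (z, φ z))
    (continuousAt_id.prodMk hφ) hf hi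
    (by filter_upwards [hz] with z hz; simp [hz]) hM
  exact key.differentiableAt.snd

/-- A continuous injective function on a compact interval around one of its zeros takes values of
opposite sign at the endpoints. -/
theorem mul_neg_of_injOn_Icc {f : ℝ → ℝ} {t d : ℝ} (hd : 0 < d)
    (hc : ContinuousOn f (Icc (t - d) (t + d))) (hi : InjOn f (Icc (t - d) (t + d)))
    (hz : f t = 0) : f (t - d) * f (t + d) < 0 := by
  have h1 : t - d ∈ Icc (t - d) (t + d) := ⟨by linarith, by linarith⟩
  have h2 : t ∈ Icc (t - d) (t + d) := ⟨by linarith, by linarith⟩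
  have h3 : t + d ∈ Icc (t - d) (t + d) := ⟨by linarith, by linarith⟩
  rcases hc.strictMonoOn_of_injOn_Icc' (by linarith) hi with hm | hm
  · have := hm h1 h2 (by linarith)
    have := hm h2 h3 (by linarith)
    exact mul_neg_of_neg_of_pos (by linarith) (by linarith)
  · have := hm h1 h2 (by linarith)
    have := hm h2 h3 (by linarith)
    exact mul_neg_of_pos_of_neg (by linarith) (by linarith)

/-- A continuous function with values of opposite sign at the endpoints of an interval has a zero
in its interior. -/
theorem exists_zero_of_mul_neg {f : ℝ → ℝ} {u v : ℝ} (huv : u ≤ v)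
    (hc : ContinuousOn f (Icc u v)) (hn : f u * f v < 0) : ∃ t ∈ Ioo u v, f t = 0 := by
  rcases mul_neg_iff.1 hn with ⟨hp, hq⟩ | ⟨hp, hq⟩
  · obtain ⟨t, ht, h0⟩ := intermediate_value_Ioo' huv hc ⟨hq, hp⟩
    exact ⟨t, ht, h0⟩
  · obtain ⟨t, ht, h0⟩ := intermediate_value_Ioo huv hc ⟨hp, hq⟩
    exact ⟨t, ht, h0⟩

/-- The implicit function theorem for one scalar unknown and a differentiable equation. -/
theorem exists_implicit_scalar {E : Type*} [NormedAddCommGroup E] [NormedSpace ℝ E]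
    {h : E × ℝ → ℝ} {a : E} {β : ℝ}
    (hh : ∀ᶠ p in 𝓝 (a, β), DifferentiableAt ℝ h p ∧ fderiv ℝ h p (0, 1) ≠ 0)
    (h0 : h (a, β) = 0) :
    ∃ φ : E → ℝ, φ a = β ∧ ∀ᶠ x in 𝓝 a, DifferentiableAt ℝ φ x ∧ h (x, φ x) = 0 := by
  obtain ⟨ε, hε, hball⟩ := Metric.eventually_nhds_iff_ball.1 hh
  set B := Metric.ball a ε
  set I := Metric.ball β ε
  have hgood : ∀ x ∈ B, ∀ t ∈ I,
      DifferentiableAt ℝ h (x, t) ∧ fderiv ℝ h (x, t) (0, 1) ≠ 0 := fun x hx t ht =>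
    hball (x, t) (by rw [← ball_prod_same]; exact ⟨hx, ht⟩)
  have hder : ∀ x ∈ B, ∀ t ∈ I,
      HasDerivAt (fun s => h (x, s)) (fderiv ℝ h (x, t) (0, 1)) t := fun x hx t ht =>
    (hgood x hx t ht).1.hasFDerivAt.comp_hasDerivAt t
      ((hasDerivAt_const t x).prodMk (hasDerivAt_id t))
  have hcont : ∀ x ∈ B, ContinuousOn (fun s => h (x, s)) I := fun x hx t ht =>
    (hder x hx t ht).continuousAt.continuousWithinAt
  have hIconv : I.OrdConnected := (convex_ball β ε).ordConnected
  have hlt : ∀ x ∈ B, ∀ s ∈ I, ∀ t ∈ I, s < t → h (x, s) ≠ h (x, t) := by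
    intro x hx s hs t ht hst heq
    have hsub : Icc s t ⊆ I := hIconv.out hs ht
    obtain ⟨c, hc, hc0⟩ := exists_hasDerivAt_eq_zero hst ((hcont x hx).mono hsub) heq
      fun u hu => hder x hx u (hsub (Ioo_subset_Icc_self hu))
    exact (hgood x hx c (hsub (Ioo_subset_Icc_self hc))).2 hc0
  have hinj : ∀ x ∈ B, InjOn (fun s => h (x, s)) I := by
    intro x hx s hs t ht heq
    rcases lt_trichotomy s t with hst | hst | hst
    · exact absurd heq (hlt x hx s hs t ht hst)
    · exact hst
    · exact absurd heq.symm (hlt x hx t ht s hs hst)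
  have hstable : ∀ x ∈ B, ∀ t ∈ I, h (x, t) = 0 → ∀ δ > 0,
      ∀ᶠ z in 𝓝 x, ∃ s ∈ I, dist s t < δ ∧ h (z, s) = 0 := by
    intro x hx t ht hxt δ hδ
    obtain ⟨ρ, hρ, hρI⟩ := Metric.isOpen_iff.1 Metric.isOpen_ball t ht
    set d := min ρ δ / 2
    have hd : 0 < d := half_pos (lt_min hρ hδ)
    have hdρ : d < ρ := (half_lt_self (lt_min hρ hδ)).trans_le (min_le_left _ _)
    have hdδ : d < δ := (half_lt_self (lt_min hρ hδ)).trans_le (min_le_right _ _)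
    have hsub : Icc (t - d) (t + d) ⊆ I := by
      rw [← Real.closedBall_eq_Icc]
      exact (Metric.closedBall_subset_ball hdρ).trans hρI
    have hneg := mul_neg_of_injOn_Icc hd ((hcont x hx).mono hsub) ((hinj x hx).mono hsub) hxt
    have hc : ∀ s ∈ I, ContinuousAt (fun z => h (z, s)) x := fun s hs =>
      ContinuousAt.comp (g := h) (f := fun z => (z, s)) (hgood x hx s hs).1.continuousAt
        (by fun_prop)
    have hev := ((hc (t - d) (hsub ⟨le_rfl, by linarith⟩)).mul
      (hc (t + d) (hsub ⟨by linarith, le_rfl⟩))).eventually_lt_const hneg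
    filter_upwards [hev, Metric.isOpen_ball.mem_nhds hx] with z hz hzB
    obtain ⟨s, hs, hs0⟩ := exists_zero_of_mul_neg (by linarith) ((hcont z hzB).mono hsub) hz
    refine ⟨s, hsub (Ioo_subset_Icc_self hs), ?_, hs0⟩
    rw [Real.dist_eq, abs_lt]
    constructor <;> linarith [hs.1, hs.2]
  have ha : a ∈ B := Metric.mem_ball_self hε
  have hβ : β ∈ I := Metric.mem_ball_self hε
  classical
  let φ : E → ℝ := fun x => if hx : ∃ s ∈ I, h (x, s) = 0 then hx.choose else β
  have hφ : ∀ x ∈ B, ∀ s ∈ I, h (x, s) = 0 → φ x = s := by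
    intro x hx s hs hs0
    have hex : ∃ s ∈ I, h (x, s) = 0 := ⟨s, hs, hs0⟩
    have hval : φ x = hex.choose := dif_pos hex
    rw [hval]
    exact hinj x hx hex.choose_spec.1 hs (hex.choose_spec.2.trans hs0.symm)
  have hφa : φ a = β := hφ a ha β hβ h0
  have hsolves : ∀ x ∈ B, ∀ t ∈ I, h (x, t) = 0 →
      ∀ᶠ z in 𝓝 x, z ∈ B ∧ φ z ∈ I ∧ h (z, φ z) = 0 := by
    intro x hx t ht hxt
    filter_upwards [hstable x hx t ht hxt 1 one_pos, Metric.isOpen_ball.mem_nhds hx]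
      with z ⟨s, hs, _, hs0⟩ hz
    rw [hφ z hz s hs hs0]
    exact ⟨hz, hs, hs0⟩
  refine ⟨φ, hφa, ?_⟩
  filter_upwards [hsolves a ha β hβ h0] with x ⟨hx, hxI, hx0⟩
  have hcφ : ContinuousAt φ x := by
    refine Metric.tendsto_nhds.2 fun δ hδ => ?_
    filter_upwards [hstable x hx _ hxI hx0 δ hδ, Metric.isOpen_ball.mem_nhds hx]
      with z ⟨s, hs, hsd, hs0⟩ hz
    rwa [hφ z hz s hs hs0]
  exact ⟨differentiableAt_of_implicit_scalar hcφ (hgood x hx _ hxI).1 (hgood x hx _ hxI).2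
    ((hsolves x hx _ hxI hx0).mono fun z hz => hz.2.2), hx0⟩

/-- Appending a last coordinate to a vector, as a continuous linear map. -/
noncomputable def snocCLM (m : ℕ) : (Fin m → ℝ) × ℝ →L[ℝ] (Fin (m + 1) → ℝ) :=
  LinearMap.toContinuousLinearMap
    { toFun := fun p => Fin.snoc (α := fun _ => ℝ) p.1 p.2
      map_add' := fun p q => by
        ext i
        refine Fin.lastCases ?_ (fun j => ?_) i <;> simp
      map_smul' := fun c p => by
        ext i
        refine Fin.lastCases ?_ (fun j => ?_) i <;> simp }

@[simp]
theorem snocCLM_castSucc {m : ℕ} (p : (Fin m → ℝ) × ℝ) (i : Fin m) :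
    snocCLM m p i.castSucc = p.1 i := by
  simp [snocCLM]

@[simp]
theorem snocCLM_last {m : ℕ} (p : (Fin m → ℝ) × ℝ) : snocCLM m p (Fin.last m) = p.2 := by
  simp [snocCLM]

/-- All leading principal blocks of an endomorphism of `Fin m → ℝ` have trivial kernel. -/
def LeadingBlocksInjective {m : ℕ} (T : (Fin m → ℝ) → (Fin m → ℝ)) : Prop :=
  ∀ k ≤ m, ∀ v : Fin m → ℝ, (∀ j : Fin m, k ≤ j → v j = 0) →
    (∀ i : Fin m, (i : ℕ) < k → T v i = 0) → v = 0

/-- The implicit function theorem for a differentiable system whose partial Jacobian has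
injective leading principal blocks. -/
theorem exists_implicit_pi (m : ℕ) {E : Type*} [NormedAddCommGroup E] [NormedSpace ℝ E]
    (F : E × (Fin m → ℝ) → (Fin m → ℝ)) (a : E) (b : Fin m → ℝ)
    (hF : ∀ᶠ p in 𝓝 (a, b), DifferentiableAt ℝ F p ∧
      LeadingBlocksInjective fun v => fderiv ℝ F p (0, v))
    (h0 : F (a, b) = 0) :
    ∃ g : E → Fin m → ℝ, g a = b ∧ ∀ᶠ x in 𝓝 a, DifferentiableAt ℝ g x ∧ F (x, g x) = 0 := by
  induction m generalizing E with
  | zero =>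
    exact ⟨fun _ => b, rfl, Eventually.of_forall fun x =>
      ⟨differentiableAt_const b, Subsingleton.elim _ _⟩⟩
  | succ m ih =>
    set β : ℝ := b (Fin.last m)
    set b' : Fin m → ℝ := fun i => b i.castSucc
    have hb : snocCLM m (b', β) = b := by
      ext i
      refine Fin.lastCases ?_ (fun j => ?_) i <;> simp [β, b']
    let A : (E × ℝ) × (Fin m → ℝ) →L[ℝ] E × (Fin (m + 1) → ℝ) :=
      ((ContinuousLinearMap.fst ℝ E ℝ).comp (ContinuousLinearMap.fst ℝ _ _)).prod
        ((snocCLM m).comp ((ContinuousLinearMap.snd ℝ (E × ℝ) (Fin m → ℝ)).prod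
          ((ContinuousLinearMap.snd ℝ E ℝ).comp (ContinuousLinearMap.fst ℝ _ _))))
    have hA : ∀ x t w, A ((x, t), w) = (x, snocCLM m (w, t)) := fun _ _ _ => rfl
    let P : (Fin (m + 1) → ℝ) →L[ℝ] (Fin m → ℝ) :=
      ContinuousLinearMap.pi fun i => ContinuousLinearMap.proj i.castSucc
    have hP : ∀ v i, P v i = v (Fin.castSucc i) := fun _ _ => rfl
    have hAab : A ((a, β), b') = (a, b) := by rw [hA, hb]
    have hFA : ∀ᶠ q in 𝓝 ((a, β), b'), DifferentiableAt ℝ F (A q) ∧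
        LeadingBlocksInjective fun v => fderiv ℝ F (A q) (0, v) := by
      refine A.continuous.continuousAt.eventually (p := fun p => DifferentiableAt ℝ F p ∧
        LeadingBlocksInjective fun v => fderiv ℝ F p (0, v)) ?_
      rwa [hAab]
    obtain ⟨ψ, hψa, hψ⟩ := ih (fun q => P (F (A q))) (a, β) b' (by
      filter_upwards [hFA] with q ⟨hd, hinj⟩
      have hd' : HasFDerivAt (fun q => P (F (A q))) (P.comp ((fderiv ℝ F (A q)).comp A)) q :=
        P.hasFDerivAt.comp q (hd.hasFDerivAt.comp q A.hasFDerivAt)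
      refine ⟨hd'.differentiableAt, fun k hk v hv hTv => ?_⟩
      rw [hd'.fderiv] at hTv
      have hAv : A (0, v) = (0, snocCLM m (v, 0)) := hA 0 0 v
      have hz := hinj k (by omega) (snocCLM m (v, 0)) (fun j => by
          refine Fin.lastCases ?_ (fun j => ?_) j
          · simp
          · simpa using hv j)
        (fun i => by
          refine Fin.lastCases ?_ (fun i hi => ?_) i
          · intro hi
            simp at hi
            omega
          · have := hTv i (by simpa using hi)
            simpa [hP, hAv] using this)
      ext i
      simpa using congrFun hz i.castSucc) (by
      simp [hAab, h0])
    let σ : E × ℝ → (E × ℝ) × (Fin m → ℝ) := fun q => (q, ψ q)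
    have hσa : σ (a, β) = ((a, β), b') := by simp [σ, hψa]
    have hψc : ContinuousAt σ (a, β) :=
      continuousAt_id.prodMk hψ.self_of_nhds.1.continuousAt
    have hFσ : ∀ᶠ q in 𝓝 (a, β), DifferentiableAt ℝ F (A (σ q)) ∧
        LeadingBlocksInjective fun v => fderiv ℝ F (A (σ q)) (0, v) := by
      refine hψc.eventually (p := fun q => DifferentiableAt ℝ F (A q) ∧
        LeadingBlocksInjective fun v => fderiv ℝ F (A q) (0, v)) ?_
      rwa [hσa]
    obtain ⟨φ, hφa, hφ⟩ := exists_implicit_scalar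
      (h := fun q => F (A (σ q)) (Fin.last m)) (a := a) (β := β) (by
        filter_upwards [hFσ, hψ.eventually_nhds] with q ⟨hd, hinj⟩ hψq
        obtain ⟨hψd, -⟩ := hψq.self_of_nhds
        have hσd : HasFDerivAt σ ((ContinuousLinearMap.id ℝ _).prod (fderiv ℝ ψ q)) q :=
          (hasFDerivAt_id q).prodMk hψd.hasFDerivAt
        set D := (fderiv ℝ F (A (σ q))).comp
          (A.comp ((ContinuousLinearMap.id ℝ _).prod (fderiv ℝ ψ q)))
        have hcomp : HasFDerivAt (fun q => F (A (σ q))) D q :=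
          hd.hasFDerivAt.comp q (A.hasFDerivAt.comp q hσd)
        have hlast := hasFDerivAt_pi'.1 hcomp (Fin.last m)
        refine ⟨hlast.differentiableAt, fun hzero => ?_⟩
        rw [hlast.fderiv] at hzero
        have hinit : P.comp D = 0 := by
          have h1 : HasFDerivAt (fun q => P (F (A (σ q)))) (P.comp D) q :=
            P.hasFDerivAt.comp q hcomp
          refine h1.unique ((hasFDerivAt_const (0 : Fin m → ℝ) q).congr_of_eventuallyEq ?_)
          filter_upwards [hψq] with z hz using hz.2
        have hDv : D (0, 1) =
            fderiv ℝ F (A (σ q)) (0, snocCLM m (fderiv ℝ ψ q (0, 1), 1)) := rfl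
        have hz := hinj (m + 1) le_rfl (snocCLM m (fderiv ℝ ψ q (0, 1), 1))
          (fun j hj => absurd j.2 (by omega))
          (fun i _ => by
            change fderiv ℝ F (A (σ q)) (0, snocCLM m (fderiv ℝ ψ q (0, 1), 1)) i = 0
            rw [← hDv]
            refine Fin.lastCases ?_ (fun i => ?_) i
            · simpa using hzero
            · exact congrFun (DFunLike.congr_fun hinit ((0 : E), (1 : ℝ))) i)
        have := congrFun hz (Fin.last m)
        simp at this) (by
      simp [hσa, hAab, h0])
    refine ⟨fun x => snocCLM m (ψ (x, φ x), φ x), by simp only [hφa, hψa, hb], ?_⟩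
    have hφc : ContinuousAt (fun x => (x, φ x)) a :=
      continuousAt_id.prodMk hφ.self_of_nhds.1.continuousAt
    have hψφ : ∀ᶠ x in 𝓝 a, DifferentiableAt ℝ ψ (x, φ x) ∧
        P (F (A ((x, φ x), ψ (x, φ x)))) = 0 := by
      refine hφc.eventually (p := fun q => DifferentiableAt ℝ ψ q ∧ P (F (A (q, ψ q))) = 0) ?_
      simpa only [hφa] using hψ
    filter_upwards [hφ, hψφ] with x ⟨hφd, hφ0⟩ ⟨hψd, hψ0⟩
    constructor
    · have h1 : DifferentiableAt ℝ (fun x => (x, φ x)) x := differentiableAt_id.prodMk hφd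
      have h2 : DifferentiableAt ℝ (fun x => ψ (x, φ x)) x :=
        DifferentiableAt.comp (g := ψ) x hψd h1
      exact (snocCLM m).differentiableAt.comp x (h2.prodMk hφd)
    · ext i
      refine Fin.lastCases ?_ (fun i => ?_) i
      · exact hφ0
      · exact congrFun hψ0 i

/-- A continuous linear endomorphism of Euclidean space with nonzero leading principal minors has
injective leading principal blocks. -/
theorem leadingBlocksInjective_of_minors {m : ℕ}
    (T : EuclideanSpace ℝ (Fin m) →L[ℝ] EuclideanSpace ℝ (Fin m))
    (hT : ∀ k : ℕ, 1 ≤ k → ∀ hk : k ≤ m, (Matrix.of fun i j : Fin k =>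
      T (EuclideanSpace.single (Fin.castLE hk j) (1 : ℝ)) (Fin.castLE hk i)).det ≠ 0) :
    LeadingBlocksInjective fun v => (T (WithLp.toLp 2 v)).ofLp := by
  intro k hk v hv hTv
  rcases Nat.eq_zero_or_pos k with rfl | hk0
  · ext j
    exact hv j (Nat.zero_le _)
  have hsum : WithLp.toLp 2 v =
      ∑ j : Fin k, v (Fin.castLE hk j) • EuclideanSpace.single (Fin.castLE hk j) (1 : ℝ) := by
    ext i
    by_cases hi : (i : ℕ) < k
    · rw [WithLp.ofLp_sum, Finset.sum_apply, Finset.sum_eq_single ⟨i, hi⟩]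
      · simp
      · intro j _ hj
        have : i ≠ Fin.castLE hk j := fun h => hj (by ext; simp [h])
        simp [this]
      · simp
    · rw [WithLp.ofLp_sum, Finset.sum_apply, Finset.sum_eq_zero]
      · exact hv i (by omega)
      · intro j _
        have : i ≠ Fin.castLE hk j := fun h => hi (by simp [h])
        simp [this]
  have hw := Matrix.eq_zero_of_mulVec_eq_zero (hT k hk0 hk)
    (v := fun j => v (Fin.castLE hk j)) (by
      ext i
      have := hTv (Fin.castLE hk i) (by simp)
      simp only [hsum, map_sum, map_smul, WithLp.ofLp_sum, Finset.sum_apply, WithLp.ofLp_smul,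
        Pi.smul_apply, smul_eq_mul] at this
      simpa [Matrix.mulVec, dotProduct, mul_comm] using this)
  ext j
  by_cases hj : (j : ℕ) < k
  · exact congrFun hw ⟨j, hj⟩
  · exact hv j (by omega)

/-- **The implicit function theorem (existence of a differentiable implicit solution).**
Let `Ω` be a non-degenerate open ball in `ℝⁿ × ℝᵐ` centered at `(a,b)`, let
`F : Ω → ℝᵐ` be differentiable at every point of `Ω` with `F(a,b) = 0`, and assume that
for every `k = 1,…,m` the `k`-th order leading principal minor of the matrix
`∂F/∂y(x,y) = (∂Fᵢ/∂yⱼ(x,y))` is nonzero at every point of `Ω`. Then there are open sets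
`X ∋ a`, `Y ∋ b` with `X × Y ⊆ Ω` and a differentiable `g : X → Y` with
`F(x, g x) = 0` on `X` and `g a = b`. -/
theorem implicit_function_theorem_existence {n m : ℕ}
    (a : EuclideanSpace ℝ (Fin n)) (b : EuclideanSpace ℝ (Fin m)) (r : ℝ) (hr : 0 < r)
    (F : EuclideanSpace ℝ (Fin n) × EuclideanSpace ℝ (Fin m) → EuclideanSpace ℝ (Fin m))
    (hF : ∀ p ∈ Metric.ball (a, b) r, DifferentiableAt ℝ F p)
    (hFab : F (a, b) = 0)
    (hminors : ∀ p ∈ Metric.ball (a, b) r, ∀ k : ℕ, 1 ≤ k → ∀ hk : k ≤ m,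
      (Matrix.of fun i j : Fin k =>
          fderiv ℝ F p ((0 : EuclideanSpace ℝ (Fin n)),
            EuclideanSpace.single (Fin.castLE hk j) (1 : ℝ)) (Fin.castLE hk i)).det ≠ 0) :
    ∃ (X : Set (EuclideanSpace ℝ (Fin n))) (Y : Set (EuclideanSpace ℝ (Fin m))),
      IsOpen X ∧ IsOpen Y ∧ a ∈ X ∧ b ∈ Y ∧ X ×ˢ Y ⊆ Metric.ball (a, b) r ∧
      ∃ g : EuclideanSpace ℝ (Fin n) → EuclideanSpace ℝ (Fin m),
        (∀ x ∈ X, g x ∈ Y) ∧ (∀ x ∈ X, DifferentiableAt ℝ g x) ∧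
        (∀ x ∈ X, F (x, g x) = 0) ∧ g a = b := by
  let e := EuclideanSpace.equiv (Fin m) ℝ
  let S : EuclideanSpace ℝ (Fin n) × (Fin m → ℝ) →L[ℝ]
      EuclideanSpace ℝ (Fin n) × EuclideanSpace ℝ (Fin m) :=
    (ContinuousLinearMap.id ℝ _).prodMap (e.symm : (Fin m → ℝ) →L[ℝ] EuclideanSpace ℝ (Fin m))
  have hSab : S (a, e b) = (a, b) := rfl
  have hball : ∀ᶠ q in 𝓝 (a, e b), S q ∈ Metric.ball (a, b) r := by
    refine S.continuous.continuousAt.eventually (p := fun p => p ∈ Metric.ball (a, b) r) ?_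
    rw [hSab]
    exact Metric.ball_mem_nhds _ hr
  obtain ⟨g, hga, hg⟩ := exists_implicit_pi m (fun q => e (F (S q))) a (e b) (by
    filter_upwards [hball] with q hq
    have hd : HasFDerivAt (fun q => e (F (S q)))
        ((e : EuclideanSpace ℝ (Fin m) →L[ℝ] (Fin m → ℝ)).comp
          ((fderiv ℝ F (S q)).comp S)) q :=
      e.hasFDerivAt.comp q ((hF _ hq).hasFDerivAt.comp q S.hasFDerivAt)
    refine ⟨hd.differentiableAt, ?_⟩
    rw [hd.fderiv]
    have := leadingBlocksInjective_of_minors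
      ((fderiv ℝ F (S q)).comp (ContinuousLinearMap.inr ℝ _ _)) (hminors _ hq)
    exact this) (by simp [hSab, hFab])
  have hgc : ContinuousAt (fun x => e.symm (g x)) a :=
    e.symm.continuous.continuousAt.comp hg.self_of_nhds.1.continuousAt
  have hgb : e.symm (g a) = b := by simp [hga]
  have hY : ∀ᶠ x in 𝓝 a, e.symm (g x) ∈ Metric.ball b r := by
    refine hgc.eventually (p := fun y => y ∈ Metric.ball b r) ?_
    simp only [hgb]
    exact Metric.ball_mem_nhds _ hr
  obtain ⟨X, hX, hXo, haX⟩ := eventually_nhds_iff.1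
    ((hg.and hY).and (Metric.ball_mem_nhds a hr))
  refine ⟨X, Metric.ball b r, hXo, Metric.isOpen_ball, haX, Metric.mem_ball_self hr, ?_,
    fun x => e.symm (g x), fun x hx => (hX x hx).1.2, fun x hx => ?_, fun x hx => ?_, hgb⟩
  · rw [← ball_prod_same]
    exact prod_mono (fun x hx => (hX x hx).2) Subset.rfl
  · exact e.symm.differentiableAt.comp x (hX x hx).1.1.1
  · exact e.injective ((hX x hx).1.1.2.trans (map_zero e).symm)
end

section
/- Let Ω be a non-degenerate open ball in ℝⁿ × ℝᵐ centered at (a,b), let F = (F₁,…,Fₘ) : Ω → ℝᵐ be differentiable at every point of Ω, and suppose that for every choice of m² points ξᵢⱼ ∈ Ω (1 ≤ i,j ≤ m) the determinant of the m×m matrix whose (i,j)-entry is ∂Fᵢ/∂yⱼ(ξᵢⱼ) is nonzero. If X ⊆ ℝⁿ and Y ⊆ ℝᵐ are sets with X × Y ⊆ Ω and g : X → Y and h : X → Y both satisfy F(x, g(x)) = 0 and F(x, h(x)) = 0 for all x in X, then h = g. -/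
/-- The mean value theorem, applied to a component of a map into Euclidean space, on a convex
set. -/
theorem Convex.exists_fderiv_component_eq_sub {E ι : Type*} [NormedAddCommGroup E]
    [NormedSpace ℝ E] [Fintype ι] {s : Set E} (hs : Convex ℝ s) {f : E → EuclideanSpace ℝ ι}
    (hf : ∀ p ∈ s, DifferentiableAt ℝ f p) {x y : E} (hx : x ∈ s) (hy : y ∈ s) (i : ι) :
    ∃ z ∈ s, fderiv ℝ f z (y - x) i = f y i - f x i := by
  have hd : ∀ p ∈ s, HasFDerivWithinAt (fun q => f q i)
      ((EuclideanSpace.proj (𝕜 := ℝ) i).comp (fderiv ℝ f p)) s p := fun p hp =>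
    ((EuclideanSpace.proj (𝕜 := ℝ) i).hasFDerivAt.comp p (hf p hp).hasFDerivAt).hasFDerivWithinAt
  obtain ⟨z, hz, hzeq⟩ := domain_mvt hd hs hx hy
  exact ⟨z, hs.segment_subset hx hy hz, by simpa using hzeq.symm⟩

/-- A linear map on `E × ℝᵐ` applied to a vector `(0, v)`, expanded along the standard basis. -/
theorem ContinuousLinearMap.map_zero_prod_euclidean {E G ι : Type*} [NormedAddCommGroup E]
    [NormedSpace ℝ E] [NormedAddCommGroup G] [NormedSpace ℝ G] [Fintype ι] [DecidableEq ι]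
    (L : E × EuclideanSpace ℝ ι →L[ℝ] G) (v : EuclideanSpace ℝ ι) :
    L (0, v) = ∑ j, v j • L (0, EuclideanSpace.single j (1 : ℝ)) := by
  have hv : v = ∑ j, v j • EuclideanSpace.single j (1 : ℝ) := by
    simpa using ((EuclideanSpace.basisFun ι ℝ).sum_repr v).symm
  have hL := congrArg (L.comp (ContinuousLinearMap.inr ℝ E (EuclideanSpace ℝ ι))) hv
  simpa only [map_sum, map_smul, ContinuousLinearMap.comp_apply,
    ContinuousLinearMap.inr_apply] using hL

/-- **The implicit function theorem (uniqueness of the implicit solution).** Let `Ω` be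
a non-degenerate open ball in `ℝⁿ × ℝᵐ` centered at `(a,b)` and `F : Ω → ℝᵐ`
differentiable at every point of `Ω`. Assume that for every choice of `m²` points
`ξᵢⱼ ∈ Ω` the determinant `det (∂Fᵢ/∂yⱼ(ξᵢⱼ))` is nonzero. If `X × Y ⊆ Ω` and
`g, h : X → Y` both satisfy `F(x, g x) = 0` and `F(x, h x) = 0` for all `x ∈ X`,
then `h = g` on `X`. -/
theorem implicit_function_theorem_uniqueness {n m : ℕ}
    (a : EuclideanSpace ℝ (Fin n)) (b : EuclideanSpace ℝ (Fin m)) (r : ℝ) (hr : 0 < r)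
    (F : EuclideanSpace ℝ (Fin n) × EuclideanSpace ℝ (Fin m) → EuclideanSpace ℝ (Fin m))
    (hF : ∀ p ∈ Metric.ball (a, b) r, DifferentiableAt ℝ F p)
    (hdet : ∀ ξ : Fin m → Fin m → EuclideanSpace ℝ (Fin n) × EuclideanSpace ℝ (Fin m),
      (∀ i j, ξ i j ∈ Metric.ball (a, b) r) →
      (Matrix.of fun i j : Fin m =>
        fderiv ℝ F (ξ i j) ((0 : EuclideanSpace ℝ (Fin n)),
          EuclideanSpace.single j (1 : ℝ)) i).det ≠ 0)
    (X : Set (EuclideanSpace ℝ (Fin n))) (Y : Set (EuclideanSpace ℝ (Fin m)))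
    (hXY : X ×ˢ Y ⊆ Metric.ball (a, b) r)
    (g h : EuclideanSpace ℝ (Fin n) → EuclideanSpace ℝ (Fin m))
    (hgY : ∀ x ∈ X, g x ∈ Y) (hhY : ∀ x ∈ X, h x ∈ Y)
    (hgF : ∀ x ∈ X, F (x, g x) = 0) (hhF : ∀ x ∈ X, F (x, h x) = 0) :
    ∀ x ∈ X, h x = g x := by
  intro x hx
  have hgΩ : (x, g x) ∈ Metric.ball (a, b) r := hXY ⟨hx, hgY x hx⟩
  have hhΩ : (x, h x) ∈ Metric.ball (a, b) r := hXY ⟨hx, hhY x hx⟩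
  choose ξ hξ hξF using fun i =>
    (convex_ball (a, b) r).exists_fderiv_component_eq_sub hF hgΩ hhΩ i
  have hker : (Matrix.of fun i j : Fin m => fderiv ℝ F (ξ i)
      ((0 : EuclideanSpace ℝ (Fin n)), EuclideanSpace.single j (1 : ℝ)) i).mulVec
      (fun j => (h x - g x) j) = 0 := by
    funext i
    have hi := hξF i
    rw [hgF x hx, hhF x hx, Prod.mk_sub_mk, sub_self x, sub_self,
      ContinuousLinearMap.map_zero_prod_euclidean] at hi
    simpa [Matrix.mulVec, dotProduct, mul_comm] using hi
  have hzero := Matrix.eq_zero_of_mulVec_eq_zero (hdet (fun i _ => ξ i) fun i _ => hξ i) hker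
  ext j
  exact sub_eq_zero.mp (congrFun hzero j)
end

section
/- Let Ω be a non-degenerate open ball in ℝⁿ centered at x₀, and let F = (F₁,…,Fₙ) : Ω → ℝⁿ be differentiable at every point of Ω. Suppose that for every choice of n² points ξᵢⱼ ∈ Ω (1 ≤ i,j ≤ n) the determinant of the n×n matrix whose (i,j)-entry is ∂Fᵢ/∂xⱼ(ξᵢⱼ) is nonzero. Then F is injective on Ω. -/
/-- **Injectivity in the inverse function theorem.** Let `Ω` be a non-degenerate open
ball in `ℝⁿ` centered at `x₀` and `F = (F₁,…,Fₙ) : Ω → ℝⁿ` differentiable at every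
point of `Ω`. If for every choice of `n²` points `ξᵢⱼ ∈ Ω` the determinant of the
matrix with `(i,j)`-entry `∂Fᵢ/∂xⱼ(ξᵢⱼ)` is nonzero, then `F` is injective on `Ω`. -/
theorem inverse_function_theorem_injectivity {n : ℕ}
    (x₀ : EuclideanSpace ℝ (Fin n)) (r : ℝ) (hr : 0 < r)
    (F : EuclideanSpace ℝ (Fin n) → EuclideanSpace ℝ (Fin n))
    (hF : ∀ x ∈ Metric.ball x₀ r, DifferentiableAt ℝ F x)
    (hdet : ∀ ξ : Fin n → Fin n → EuclideanSpace ℝ (Fin n),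
      (∀ i j, ξ i j ∈ Metric.ball x₀ r) →
      (Matrix.of fun i j : Fin n =>
        fderiv ℝ F (ξ i j) (EuclideanSpace.single j (1 : ℝ)) i).det ≠ 0) :
    Set.InjOn F (Metric.ball x₀ r) := by
  intro x hx y hy hxy
  by_contra hne
  have hcrit (i : Fin n) : ∃ z ∈ Metric.ball x₀ r, fderiv ℝ F z (y - x) i = 0 := by
    let p : EuclideanSpace ℝ (Fin n) →L[ℝ] ℝ := EuclideanSpace.proj i
    obtain ⟨z, hz, h⟩ := domain_mvt (f := fun w => p (F w))
      (f' := fun w => p.comp (fderiv ℝ F w))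
      (fun w hw => (p.hasFDerivAt.comp w (hF w hw).hasFDerivAt).hasFDerivWithinAt)
      (convex_ball x₀ r) hx hy
    refine ⟨z, (convex_ball x₀ r).segment_subset hx hy hz, ?_⟩
    rw [hxy, sub_self] at h
    exact h.symm
  choose η hη hzero using hcrit
  refine hdet (fun i _ => η i) (fun i _ => hη i)
    (Matrix.exists_mulVec_eq_zero_iff.mp ⟨(y - x).ofLp, ?_, ?_⟩)
  · intro h
    exact hne (sub_eq_zero.mp (WithLp.ofLp_injective 2 h)).symm
  · ext i
    have hsum : y - x = ∑ j, (y - x) j • EuclideanSpace.single j (1 : ℝ) := by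
      simpa using ((EuclideanSpace.basisFun (Fin n) ℝ).sum_repr (y - x)).symm
    have h := hzero i
    rw [hsum, map_sum] at h
    simpa [Matrix.mulVec, dotProduct, mul_comm] using h
end

section
/- Let Ω be a non-degenerate open ball in ℝⁿ centered at x₀, let F : Ω → ℝⁿ be differentiable at every point of Ω, suppose that for every k = 1,…,n and every x ∈ Ω the k-th order leading principal minor of the Jacobian matrix JF(x) is nonzero, and suppose moreover that for every choice of n² points ξᵢⱼ ∈ Ω the determinant of the n×n matrix whose (i,j)-entry is ∂Fᵢ/∂xⱼ(ξᵢⱼ) is nonzero. Then there exist an open set X containing x₀, an open set Y containing y₀ = F(x₀), and a differentiable map G : Y → X such that F(G(y)) = y for all y ∈ Y and G(F(x)) = x for all x ∈ X; moreover, JG(y) = [JF(G(y))]⁻¹ for all y in Y. -/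
open Filter Topology

/-- A map on an open set of a finite-dimensional space which is injective and everywhere
differentiable with surjective derivative is open at every point of that set. -/
theorem nhds_le_map_of_injOn_of_surjective_fderiv
    {E V : Type*} [NormedAddCommGroup E] [NormedSpace ℝ E] [FiniteDimensional ℝ E]
    [NormedAddCommGroup V] [InnerProductSpace ℝ V]
    {f : E → V} {s : Set E} (hs : IsOpen s) (hf : ∀ x ∈ s, DifferentiableAt ℝ f x)
    (hsurj : ∀ x ∈ s, Function.Surjective (fderiv ℝ f x)) (hinj : Set.InjOn f s)
    {x : E} (hx : x ∈ s) : 𝓝 (f x) ≤ map f (𝓝 x) := by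
  have : ProperSpace E := FiniteDimensional.proper_real E
  intro t ht
  obtain ⟨ρ, hρ, hsub⟩ : ∃ ρ > 0, Metric.closedBall x ρ ⊆ f ⁻¹' t ∩ s :=
    Metric.nhds_basis_closedBall.mem_iff.1 (inter_mem (mem_map.1 ht) (hs.mem_nhds hx))
  have hcont : ContinuousOn f (Metric.closedBall x ρ) := fun z hz =>
    (hf z (hsub hz).2).continuousAt.continuousWithinAt
  obtain ⟨m, hm, hsphere⟩ : ∃ m > 0, ∀ z ∈ Metric.sphere x ρ, m ≤ dist (f z) (f x) := by
    rcases (Metric.sphere x ρ).eq_empty_or_nonempty with he | hne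
    · exact ⟨1, one_pos, by simp [he]⟩
    · obtain ⟨z₀, hz₀, hmin⟩ := (isCompact_sphere x ρ).exists_isMinOn hne
        (continuous_dist.comp_continuousOn
          ((hcont.mono Metric.sphere_subset_closedBall).prodMk
            (continuousOn_const (c := f x))))
      refine ⟨dist (f z₀) (f x), dist_pos.2 fun h => ?_, fun z hz => hmin hz⟩
      have := hinj (hsub (Metric.sphere_subset_closedBall hz₀)).2 hx h
      rw [this, Metric.mem_sphere, dist_self] at hz₀
      exact hρ.ne hz₀
  refine mem_of_superset (Metric.ball_mem_nhds (f x) (half_pos hm)) fun y hy => ?_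
  obtain ⟨z, hz, hmin⟩ := (isCompact_closedBall x ρ).exists_isMinOn
    ⟨x, Metric.mem_closedBall_self hρ.le⟩ (continuous_dist.comp_continuousOn
      (hcont.prodMk (continuousOn_const (c := y))))
  have hzx : dist (f z) y ≤ dist (f x) y := hmin (Metric.mem_closedBall_self hρ.le)
  have hzb : z ∈ Metric.ball x ρ := by
    by_contra hcon
    have hz' : z ∈ Metric.sphere x ρ :=
      le_antisymm hz (not_lt.1 hcon)
    have h1 := hsphere z hz'
    have h2 := dist_triangle (f z) y (f x)
    have h3 : dist y (f x) < m / 2 := hy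
    rw [dist_comm (f x) y] at hzx
    linarith
  have hlocal : IsLocalMin (fun w => ‖f w - y‖ ^ 2) z := by
    filter_upwards [Metric.isOpen_ball.mem_nhds hzb] with w hw
    have h : dist (f z) y ≤ dist (f w) y := hmin (Metric.ball_subset_closedBall hw)
    rw [dist_eq_norm, dist_eq_norm] at h
    gcongr
  have hder := ((hf z (hsub hz).2).hasFDerivAt.sub_const y).norm_sq
  have hzero := hlocal.hasFDerivAt_eq_zero hder
  obtain ⟨v, hv⟩ := hsurj z (hsub hz).2 (f z - y)
  have hfz : f z = y := by
    have := congrArg (fun L => L v) hzero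
    have h : inner ℝ (f z - y) (f z - y) = 0 := by
      rw [inner_sub_left]
      simpa [hv, inner_sub_left] using this
    exact sub_eq_zero.1 (inner_self_eq_zero.1 h)
  exact hfz ▸ (hsub hz).1

theorem EuclideanSpace.sum_apply_single_mul {n : ℕ} {V : Type*} [AddCommGroup V] [Module ℝ V]
    (L : EuclideanSpace ℝ (Fin n) →ₗ[ℝ] V) (v : EuclideanSpace ℝ (Fin n)) :
    ∑ j, v j • L (EuclideanSpace.single j (1 : ℝ)) = L v := by
  conv_rhs => rw [← (EuclideanSpace.basisFun (Fin n) ℝ).sum_repr v]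
  simp

/-- If every matrix assembled from entries of the Jacobian of `F` at arbitrary points of the
convex set `s` is nonsingular, then `F` is injective on `s`. -/
theorem injOn_of_det_jacobian_ne_zero {n : ℕ}
    {s : Set (EuclideanSpace ℝ (Fin n))} (hs : Convex ℝ s)
    {F : EuclideanSpace ℝ (Fin n) → EuclideanSpace ℝ (Fin n)}
    (hF : ∀ x ∈ s, DifferentiableAt ℝ F x)
    (hdet : ∀ ξ : Fin n → Fin n → EuclideanSpace ℝ (Fin n), (∀ i j, ξ i j ∈ s) →
      (Matrix.of fun i j : Fin n =>
        fderiv ℝ F (ξ i j) (EuclideanSpace.single j (1 : ℝ)) i).det ≠ 0) :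
    Set.InjOn F s := by
  intro a ha b hb hab
  by_contra hne
  have hmvt : ∀ i : Fin n, ∃ z ∈ s, (fderiv ℝ F z (b - a)) i = 0 := fun i => by
    obtain ⟨z, hz, h⟩ := domain_mvt (f := fun x => F x i)
      (f' := fun x => (EuclideanSpace.proj i).comp (fderiv ℝ F x))
      (fun x hx => ((EuclideanSpace.proj (𝕜 := ℝ) i).hasFDerivAt.comp x
        (hF x hx).hasFDerivAt).hasFDerivWithinAt) hs ha hb
    refine ⟨z, hs.segment_subset ha hb hz, ?_⟩
    simpa [hab] using h.symm
  choose z hz hzero using hmvt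
  refine hdet (fun i _ => z i) (fun i _ => hz i) (Matrix.exists_mulVec_eq_zero_iff.1
    ⟨(b - a).ofLp, fun h => hne ?_, ?_⟩)
  · have : b - a = 0 := by ext i; exact congrFun h i
    exact (sub_eq_zero.1 this).symm
  · ext i
    have h := EuclideanSpace.sum_apply_single_mul
      ((EuclideanSpace.proj (𝕜 := ℝ) i).comp (fderiv ℝ F (z i))).toLinearMap (b - a)
    simpa [Matrix.mulVec, dotProduct, mul_comm] using h.trans (hzero i)

theorem EuclideanSpace.injective_of_det_ne_zero {n : ℕ}
    (L : EuclideanSpace ℝ (Fin n) →L[ℝ] EuclideanSpace ℝ (Fin n))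
    (hL : (Matrix.of fun i j : Fin n => L (EuclideanSpace.single j (1 : ℝ)) i).det ≠ 0) :
    Function.Injective L := by
  have hc : Set.InjOn L Set.univ :=
    injOn_of_det_jacobian_ne_zero convex_univ (fun x _ => L.differentiableAt)
      (fun ξ _ => by simpa only [ContinuousLinearMap.fderiv] using hL)
  exact Set.injOn_univ.1 hc


/-- **The inverse function theorem.** Let `Ω` be a non-degenerate open ball in `ℝⁿ`
centered at `x₀` and `F : Ω → ℝⁿ` differentiable at every point of `Ω`. Assume all the
leading principal minors of the Jacobian matrix `JF(x)` are nonzero at every `x ∈ Ω`,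
and that for every choice of `n²` points `ξᵢⱼ ∈ Ω` the determinant of the matrix with
`(i,j)`-entry `∂Fᵢ/∂xⱼ(ξᵢⱼ)` is nonzero. Then there are an open set `X ∋ x₀` (inside
`Ω`), an open set `Y ∋ y₀ = F x₀`, and a differentiable `G : Y → X` with
`F (G y) = y` on `Y`, `G (F x) = x` on `X`, and `JG(y) = [JF(G y)]⁻¹` on `Y`. -/
theorem inverse_function_theorem {n : ℕ}
    (x₀ : EuclideanSpace ℝ (Fin n)) (r : ℝ) (hr : 0 < r)
    (F : EuclideanSpace ℝ (Fin n) → EuclideanSpace ℝ (Fin n))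
    (hF : ∀ x ∈ Metric.ball x₀ r, DifferentiableAt ℝ F x)
    (hminors : ∀ x ∈ Metric.ball x₀ r, ∀ k : ℕ, 1 ≤ k → ∀ hk : k ≤ n,
      (Matrix.of fun i j : Fin k =>
        fderiv ℝ F x (EuclideanSpace.single (Fin.castLE hk j) (1 : ℝ))
          (Fin.castLE hk i)).det ≠ 0)
    (hdet : ∀ ξ : Fin n → Fin n → EuclideanSpace ℝ (Fin n),
      (∀ i j, ξ i j ∈ Metric.ball x₀ r) →
      (Matrix.of fun i j : Fin n =>
        fderiv ℝ F (ξ i j) (EuclideanSpace.single j (1 : ℝ)) i).det ≠ 0) :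
    ∃ X Y : Set (EuclideanSpace ℝ (Fin n)),
      IsOpen X ∧ IsOpen Y ∧ x₀ ∈ X ∧ F x₀ ∈ Y ∧ X ⊆ Metric.ball x₀ r ∧
      ∃ G : EuclideanSpace ℝ (Fin n) → EuclideanSpace ℝ (Fin n),
        (∀ y ∈ Y, G y ∈ X) ∧ (∀ y ∈ Y, DifferentiableAt ℝ G y) ∧
        (∀ y ∈ Y, F (G y) = y) ∧ (∀ x ∈ X, G (F x) = x) ∧
        ∀ y ∈ Y,
          (Matrix.of fun i j : Fin n =>
            fderiv ℝ G y (EuclideanSpace.single j (1 : ℝ)) i) =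
          (Matrix.of fun i j : Fin n =>
            fderiv ℝ F (G y) (EuclideanSpace.single j (1 : ℝ)) i)⁻¹ := by
  have hinj := injOn_of_det_jacobian_ne_zero (convex_ball x₀ r) hF hdet
  have hinj' : ∀ x ∈ Metric.ball x₀ r, Function.Injective (fderiv ℝ F x) := fun x hx =>
    EuclideanSpace.injective_of_det_ne_zero _ (hdet (fun _ _ => x) fun _ _ => hx)
  have hopen : ∀ x ∈ Metric.ball x₀ r, 𝓝 (F x) ≤ map F (𝓝 x) := fun x hx =>
    nhds_le_map_of_injOn_of_surjective_fderiv Metric.isOpen_ball hF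
      (fun x hx => LinearMap.injective_iff_surjective.1 (hinj' x hx)) hinj hx
  have hY : IsOpen (F '' Metric.ball x₀ r) := by
    rw [isOpen_iff_mem_nhds]
    rintro _ ⟨x, hx, rfl⟩
    exact hopen x hx (image_mem_map (Metric.isOpen_ball.mem_nhds hx))
  set G := Function.invFunOn F (Metric.ball x₀ r)
  have hGF : ∀ x ∈ Metric.ball x₀ r, G (F x) = x := hinj.leftInvOn_invFunOn
  have hG : ∀ x (hx : x ∈ Metric.ball x₀ r), ∃ e : EuclideanSpace ℝ (Fin n) ≃L[ℝ]
      EuclideanSpace ℝ (Fin n), (e : EuclideanSpace ℝ (Fin n) →L[ℝ] _) = fderiv ℝ F x ∧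
        HasFDerivAt G (e.symm : EuclideanSpace ℝ (Fin n) →L[ℝ] _) (F x) := fun x hx => by
    let e := (LinearEquiv.ofInjectiveEndo (fderiv ℝ F x).toLinearMap
      (hinj' x hx)).toContinuousLinearEquiv
    have he : (e : EuclideanSpace ℝ (Fin n) →L[ℝ] _) = fderiv ℝ F x := by
      ext1 v
      rfl
    refine ⟨e, he, HasFDerivAt.of_local_left_inverse (f := F) ?_ ?_ ?_⟩
    · rw [ContinuousAt, hGF x hx]
      refine (map_mono (hopen x hx)).trans ?_
      rw [map_map]
      refine (tendsto_id.congr' ?_ : Tendsto (G ∘ F) (𝓝 x) (𝓝 x))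
      filter_upwards [Metric.isOpen_ball.mem_nhds hx] with w hw
      exact (hGF w hw).symm
    · rw [hGF x hx, he]
      exact (hF x hx).hasFDerivAt
    · filter_upwards [hY.mem_nhds ⟨x, hx, rfl⟩]
      rintro _ ⟨w, hw, rfl⟩
      rw [hGF w hw]
  refine ⟨Metric.ball x₀ r, F '' Metric.ball x₀ r, Metric.isOpen_ball, hY,
    Metric.mem_ball_self hr, ⟨x₀, Metric.mem_ball_self hr, rfl⟩, subset_rfl, G, ?_, ?_, ?_,
    hGF, ?_⟩
  · rintro _ ⟨x, hx, rfl⟩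
    rwa [hGF x hx]
  · rintro _ ⟨x, hx, rfl⟩
    obtain ⟨e, -, h⟩ := hG x hx
    exact h.differentiableAt
  · rintro _ ⟨x, hx, rfl⟩
    rw [hGF x hx]
  · rintro _ ⟨x, hx, rfl⟩
    obtain ⟨e, he, h⟩ := hG x hx
    rw [hGF x hx, h.fderiv, ← he]
    refine (Matrix.inv_eq_left_inv ?_).symm
    ext i j
    have h := EuclideanSpace.sum_apply_single_mul ((EuclideanSpace.proj (𝕜 := ℝ) i).comp
      (e.symm : EuclideanSpace ℝ (Fin n) →L[ℝ] _)).toLinearMap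
      (e (EuclideanSpace.single j (1 : ℝ)))
    simpa [Matrix.mul_apply, Matrix.one_apply, mul_comm, Pi.single_apply] using h
end

section
/- Let Ω ⊆ ℝⁿ × ℝᵐ be open, let F : Ω → ℝᵐ be differentiable at every point of Ω, let (a,b) ∈ Ω with F(a,b) = 0, suppose the matrix-valued map (x,y) ↦ ∂F/∂y(x,y) is continuous at the point (a,b), and suppose det ∂F/∂y(a,b) ≠ 0. Then there exist open sets X ⊆ ℝⁿ containing a and Y ⊆ ℝᵐ containing b with X × Y ⊆ Ω, and a differentiable function g : X → Y with g(a) = b and F(x, g(x)) = 0 for all x ∈ X. -/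
open Filter Metric Set
open scoped Topology

/-- An implicitly defined function which is Lipschitz at a point is differentiable there, provided
the partial derivative in the second variable is invertible. -/
theorem hasFDerivAt_of_implicit_of_isBigO {E G H : Type*}
    [NormedAddCommGroup E] [NormedSpace ℝ E] [NormedAddCommGroup G] [NormedSpace ℝ G]
    [NormedAddCommGroup H] [NormedSpace ℝ H]
    {F : E × G → H} {F' : E × G →L[ℝ] H} {B : G ≃L[ℝ] H} {g : E → G} {x : E}
    (hF : HasFDerivAt F F' (x, g x)) (hB : ∀ v, F' (0, v) = B v)
    (hg : (fun x' => g x' - g x) =O[𝓝 x] fun x' => x' - x)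
    (heq : ∀ᶠ x' in 𝓝 x, F (x', g x') = F (x, g x)) :
    HasFDerivAt g (-((B.symm : H →L[ℝ] G) ∘L F' ∘L ContinuousLinearMap.inl ℝ E G)) x := by
  have hx0 : Tendsto (fun x' => x' - x) (𝓝 x) (𝓝 0) :=
    tendsto_sub_nhds_zero_iff.2 tendsto_id
  have hgc : Tendsto g (𝓝 x) (𝓝 (g x)) :=
    tendsto_sub_nhds_zero_iff.1 (hg.trans_tendsto hx0)
  have ho := (hF.isLittleO.comp_tendsto (tendsto_id.prodMk_nhds hgc)).trans_isBigO
    ((Asymptotics.isBigO_refl (fun x' => x' - x) (𝓝 x)).prod_left hg)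
  refine .of_isLittleO ?_
  refine (((-(B.symm : H →L[ℝ] G)).isBigO_comp _ _).trans_isLittleO ho).congr' ?_ .rfl
  filter_upwards [heq] with x' hx'
  have hsplit : F' (x' - x, g x' - g x) = F' (x' - x, 0) + B (g x' - g x) := by
    rw [← hB, ← map_add]; simp
  simp [hx', hsplit, add_comm, -map_sub]

/-- **Implicit function theorem** in Banach spaces, for a map that is differentiable on an open set
and whose partial derivative in the second variable is continuous and invertible at the base
point. -/
theorem exists_differentiableAt_implicit_of_continuousAt {E G H : Type*}
    [NormedAddCommGroup E] [NormedSpace ℝ E] [NormedAddCommGroup G] [NormedSpace ℝ G]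
    [CompleteSpace G] [NormedAddCommGroup H] [NormedSpace ℝ H]
    {Ω : Set (E × G)} (hΩ : IsOpen Ω) {F : E × G → H} (hF : ∀ p ∈ Ω, DifferentiableAt ℝ F p)
    {a : E} {b : G} (hab : (a, b) ∈ Ω) (hFab : F (a, b) = 0) (L : G ≃L[ℝ] H)
    (hL : fderiv ℝ F (a, b) ∘L ContinuousLinearMap.inr ℝ E G = L)
    (hcont : ContinuousAt (fun p => fderiv ℝ F p ∘L ContinuousLinearMap.inr ℝ E G) (a, b)) :
    ∃ (X : Set E) (Y : Set G), IsOpen X ∧ IsOpen Y ∧ a ∈ X ∧ b ∈ Y ∧ X ×ˢ Y ⊆ Ω ∧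
      ∃ g : E → G, (∀ x ∈ X, g x ∈ Y) ∧ (∀ x ∈ X, DifferentiableAt ℝ g x) ∧
        g a = b ∧ ∀ x ∈ X, F (x, g x) = 0 := by
  obtain ⟨K, hK0, hK⟩ : ∃ K : NNReal, 0 < K ∧ ∀ v, ‖L.symm v‖ ≤ K * ‖v‖ :=
    ⟨‖(L.symm : H →L[ℝ] G)‖₊ + 1, by positivity, fun v =>
      ((L.symm : H →L[ℝ] G).le_opNorm v).trans (by gcongr; simp)⟩
  have hK0' : (0 : ℝ) < K := hK0
  obtain ⟨c, hc⟩ : ∃ c : NNReal, c = (2 * K)⁻¹ := ⟨_, rfl⟩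
  have hc0 : 0 < c := by rw [hc]; positivity
  have hcK : (c : ℝ) * K = 1 / 2 := by rw [hc]; push_cast; field_simp
  have hKc : (K : ℝ)⁻¹ - c = c := by rw [hc]; push_cast; field_simp; norm_num
  rw [ContinuousAt, hL] at hcont
  have hev : ∀ᶠ p in 𝓝 (a, b), p ∈ Ω ∧
      ‖fderiv ℝ F p ∘L ContinuousLinearMap.inr ℝ E G - L‖ ≤ c ∧
      fderiv ℝ F p ∘L ContinuousLinearMap.inr ℝ E G ∈
        range ((↑) : (G ≃L[ℝ] H) → G →L[ℝ] H) := by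
    refine (hΩ.eventually_mem hab).and (.and ?_
      (hcont.eventually_mem (ContinuousLinearEquiv.nhds L)))
    filter_upwards [hcont (closedBall_mem_nhds _ (NNReal.coe_pos.2 hc0))] with p hp
    simpa [dist_eq_norm] using hp
  obtain ⟨R, hR, hball⟩ := Metric.eventually_nhds_iff_ball.1 hev
  replace hball : ∀ x ∈ ball a R, ∀ y ∈ ball b R, _ := fun x hx y hy =>
    hball (x, y) (ball_prod_same a b R ▸ mk_mem_prod hx hy)
  have happrox : ∀ x ∈ ball a R,
      ApproximatesLinearOn (fun y => F (x, y)) (L : G →L[ℝ] H) (ball b R) c := by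
    intro x hx y₁ hy₁ y₂ hy₂
    refine (convex_ball b R).norm_image_sub_le_of_norm_hasFDerivWithin_le'
      (f := fun y => F (x, y)) (f' := fun y => fderiv ℝ F (x, y) ∘L ContinuousLinearMap.inr ℝ E G)
      (fun y hy => ?_) (fun y hy => (hball x hx y hy).2.1) hy₂ hy₁
    exact ((hF _ (hball x hx y hy).1).hasFDerivAt.comp y
      (hasFDerivAt_prodMk_right x y)).hasFDerivWithinAt
  have hanti : ∀ x ∈ ball a R, ∀ y₁ ∈ ball b R, ∀ y₂ ∈ ball b R,
      ‖y₁ - y₂‖ ≤ 2 * K * ‖F (x, y₁) - F (x, y₂)‖ := by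
    intro x hx y₁ hy₁ y₂ hy₂
    have h1 : ‖F (x, y₁) - F (x, y₂) - L (y₁ - y₂)‖ ≤ c * ‖y₁ - y₂‖ :=
      happrox x hx y₁ hy₁ y₂ hy₂
    have h2 : ‖y₁ - y₂‖ ≤ K * ‖L (y₁ - y₂)‖ := by simpa using hK (L (y₁ - y₂))
    have h3 : ‖L (y₁ - y₂)‖ ≤ ‖F (x, y₁) - F (x, y₂)‖ + c * ‖y₁ - y₂‖ := by
      linarith [norm_sub_norm_le (L (y₁ - y₂)) (F (x, y₁) - F (x, y₂)),
        norm_sub_rev (L (y₁ - y₂)) (F (x, y₁) - F (x, y₂))]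
    have h4 := h2.trans (mul_le_mul_of_nonneg_left h3 hK0'.le)
    linear_combination 2 * h4 + 2 * ‖y₁ - y₂‖ * hcK
  have hsurj : ∀ x ∈ ball a R, ‖F (x, b)‖ ≤ c * (R / 2) → ∃ y ∈ ball b R, F (x, y) = 0 := by
    intro x hx hxb
    obtain ⟨y, hy, hy0⟩ := (happrox x hx).surjOn_closedBall_of_nonlinearRightInverse
      { toFun := L.symm, nnnorm := K, bound' := hK, right_inv' := L.apply_symm_apply }
      (half_pos hR).le (closedBall_subset_ball (half_lt_self hR))
      (show (0 : H) ∈ _ by simpa [hKc] using hxb)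
    exact ⟨y, closedBall_subset_ball (half_lt_self hR) hy, hy0⟩
  have hsmall : ∀ᶠ x in 𝓝 a, ‖F (x, b)‖ < c * (R / 2) := by
    have hcF : ContinuousAt (fun x => ‖F (x, b)‖) a :=
      ((hF _ hab).continuousAt.comp (f := fun x => (x, b)) (by fun_prop)).norm
    exact hcF.eventually_lt continuousAt_const (by simp [hFab, hc0, hR])
  obtain ⟨T, hT, hTo, haT⟩ := _root_.mem_nhds_iff.1 hsmall
  have hsol : ∀ x, ∃ y, x ∈ T ∩ ball a R → y ∈ ball b R ∧ F (x, y) = 0 := by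
    intro x
    by_cases hx : x ∈ T ∩ ball a R
    · obtain ⟨y, hy⟩ := hsurj x hx.2 (hT hx.1).le
      exact ⟨y, fun _ => hy⟩
    · exact ⟨b, fun h => absurd h hx⟩
  choose g hg using hsol
  have hXo : IsOpen (T ∩ ball a R) := hTo.inter isOpen_ball
  have haX : a ∈ T ∩ ball a R := ⟨haT, mem_ball_self hR⟩
  refine ⟨T ∩ ball a R, ball b R, hXo, isOpen_ball, haX, mem_ball_self hR,
    fun p hp => (hball p.1 hp.1.2 p.2 hp.2).1, g, fun x hx => (hg x hx).1, fun x hx => ?_, ?_,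
    fun x hx => (hg x hx).2⟩
  · obtain ⟨hxΩ, -, B, hB⟩ := hball x hx.2 (g x) (hg x hx).1
    have hdiff := (hF _ hxΩ).hasFDerivAt
    refine (hasFDerivAt_of_implicit_of_isBigO hdiff (B := B)
      (fun v => (DFunLike.congr_fun hB v).symm) ?_ ?_).differentiableAt
    · have hslice := (HasFDerivAt.comp (f := fun x' => (x', g x)) x hdiff
        (hasFDerivAt_prodMk_left x (g x))).isBigO_sub
      refine (Asymptotics.IsBigO.of_bound (2 * K) ?_).trans hslice
      filter_upwards [hXo.mem_nhds hx] with x' hx'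
      have h := hanti x' hx'.2 (g x') (hg x' hx').1 (g x) (hg x hx).1
      simpa [(hg x' hx').2, (hg x hx).2] using h
    · filter_upwards [hXo.mem_nhds hx] with x' hx'
      rw [(hg x' hx').2, (hg x hx).2]
  · have h := hanti a haX.2 (g a) (hg a haX).1 b (mem_ball_self hR)
    rw [(hg a haX).2, hFab, sub_zero, norm_zero, mul_zero] at h
    exact sub_eq_zero.1 (norm_le_zero_iff.1 h)

/-- **Implicit function theorem with partial Jacobian continuous only at the base
point.** Let `Ω ⊆ ℝⁿ × ℝᵐ` be open, `F : Ω → ℝᵐ` differentiable at every point of `Ω`,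
`(a,b) ∈ Ω` with `F(a,b) = 0`. If the matrix-valued map `(x,y) ↦ ∂F/∂y(x,y)` is
continuous at `(a,b)` and `det ∂F/∂y(a,b) ≠ 0`, then there are open sets `X ∋ a`,
`Y ∋ b` with `X × Y ⊆ Ω` and a differentiable `g : X → Y` with `g a = b` and
`F(x, g x) = 0` for all `x ∈ X`. -/
theorem implicit_function_theorem_continuity_at_base_point {n m : ℕ}
    (Ω : Set (EuclideanSpace ℝ (Fin n) × EuclideanSpace ℝ (Fin m))) (hΩ : IsOpen Ω)
    (F : EuclideanSpace ℝ (Fin n) × EuclideanSpace ℝ (Fin m) → EuclideanSpace ℝ (Fin m))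
    (hF : ∀ p ∈ Ω, DifferentiableAt ℝ F p)
    (a : EuclideanSpace ℝ (Fin n)) (b : EuclideanSpace ℝ (Fin m))
    (hab : (a, b) ∈ Ω) (hFab : F (a, b) = 0)
    (hcont : ContinuousAt
      (fun p => Matrix.of fun i j : Fin m =>
        fderiv ℝ F p ((0 : EuclideanSpace ℝ (Fin n)),
          EuclideanSpace.single j (1 : ℝ)) i) (a, b))
    (hdet : (Matrix.of fun i j : Fin m =>
      fderiv ℝ F (a, b) ((0 : EuclideanSpace ℝ (Fin n)),
        EuclideanSpace.single j (1 : ℝ)) i).det ≠ 0) :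
    ∃ (X : Set (EuclideanSpace ℝ (Fin n))) (Y : Set (EuclideanSpace ℝ (Fin m))),
      IsOpen X ∧ IsOpen Y ∧ a ∈ X ∧ b ∈ Y ∧ X ×ˢ Y ⊆ Ω ∧
      ∃ g : EuclideanSpace ℝ (Fin n) → EuclideanSpace ℝ (Fin m),
        (∀ x ∈ X, g x ∈ Y) ∧ (∀ x ∈ X, DifferentiableAt ℝ g x) ∧
        g a = b ∧ ∀ x ∈ X, F (x, g x) = 0 := by
  have hmat : ∀ p, fderiv ℝ F p ∘L ContinuousLinearMap.inr ℝ _ _ =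
      Matrix.toEuclideanCLM (n := Fin m) (𝕜 := ℝ) (Matrix.of fun i j : Fin m =>
        fderiv ℝ F p ((0 : EuclideanSpace ℝ (Fin n)), EuclideanSpace.single j (1 : ℝ)) i) := by
    intro p
    refine ContinuousLinearMap.coe_injective
      ((EuclideanSpace.basisFun (Fin m) ℝ).toBasis.ext fun j => ?_)
    ext i
    simp
  have hunit := ((Matrix.isUnit_iff_isUnit_det _).2 hdet.isUnit).map
    (Matrix.toEuclideanCLM (n := Fin m) (𝕜 := ℝ))
  rw [← hmat] at hunit
  obtain ⟨u, hu⟩ := hunit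
  refine exists_differentiableAt_implicit_of_continuousAt hΩ hF hab hFab
    (ContinuousLinearEquiv.ofUnit u) hu.symm ?_
  simp only [hmat]
  have hlin : Continuous (Matrix.toEuclideanCLM (n := Fin m) (𝕜 := ℝ)) :=
    LinearMap.continuous_of_finiteDimensional
      (Matrix.toEuclideanCLM (n := Fin m) (𝕜 := ℝ)).toAlgEquiv.toLinearMap
  exact hlin.continuousAt.comp hcont
end

section
/- Define F : ℝ² → ℝ² by F(x,y) = (8x + x³ cos(1/(x²+y²)), 8y + y³ sin(1/(x²+y²))) for (x,y) ≠ (0,0) and F(0,0) = (0,0). Then for every (x,y) with x² + y² ≤ 1, both leading principal minors of the Jacobian matrix JF(x,y) are nonzero; more precisely, |∂F₁/∂x(x,y)| ≥ 3 and |det JF(x,y)| ≥ 5. -/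
/-- The example map `F(x,y) = (8x + x³ cos(1/(x²+y²)), 8y + y³ sin(1/(x²+y²)))` for
`(x,y) ≠ (0,0)`, with `F(0,0) = (0,0)`. -/
noncomputable def exampleMap : ℝ × ℝ → ℝ × ℝ := fun p =>
  if p = (0, 0) then (0, 0)
  else (8 * p.1 + p.1 ^ 3 * Real.cos (1 / (p.1 ^ 2 + p.2 ^ 2)),
        8 * p.2 + p.2 ^ 3 * Real.sin (1 / (p.1 ^ 2 + p.2 ^ 2)))

theorem exampleMap_apply (p : ℝ × ℝ) :
    exampleMap p = (8 * p.1 + p.1 ^ 3 * Real.cos (1 / (p.1 ^ 2 + p.2 ^ 2)),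
      8 * p.2 + p.2 ^ 3 * Real.sin (1 / (p.1 ^ 2 + p.2 ^ 2))) := by
  unfold exampleMap
  split_ifs with h
  · simp [h]
  · rfl

/-- The derivative of `exampleMap` at the origin is `8` times the identity. -/
theorem hasFDerivAt_exampleMap_zero :
    HasFDerivAt exampleMap ((8 : ℝ) • ContinuousLinearMap.id ℝ (ℝ × ℝ)) 0 := by
  have hO : (fun p : ℝ × ℝ => exampleMap p - (8 : ℝ) • p) =O[nhds 0] fun p => ‖p - 0‖ ^ 3 := by
    refine Asymptotics.IsBigO.of_bound 1 (Filter.Eventually.of_forall fun p => ?_)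
    have key : ∀ a t : ℝ, |a| ≤ ‖p‖ → |t| ≤ 1 → |a ^ 3 * t| ≤ ‖p‖ ^ 3 := fun a t ha ht => by
      rw [abs_mul, abs_pow]
      exact (mul_le_of_le_one_right (by positivity) ht).trans (by gcongr)
    have hsub : exampleMap p - (8 : ℝ) • p =
        (p.1 ^ 3 * Real.cos (1 / (p.1 ^ 2 + p.2 ^ 2)),
          p.2 ^ 3 * Real.sin (1 / (p.1 ^ 2 + p.2 ^ 2))) := by
      rw [exampleMap_apply]
      ext <;> simp
    rw [hsub, sub_zero, one_mul, norm_pow, norm_norm, Prod.norm_def]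
    exact max_le (key p.1 _ (norm_fst_le p) (Real.abs_cos_le_one _))
      (key p.2 _ (norm_snd_le p) (Real.abs_sin_le_one _))
  have h := (hO.hasFDerivAt (by norm_num)).add
    ((8 : ℝ) • ContinuousLinearMap.id ℝ (ℝ × ℝ)).hasFDerivAt
  rw [zero_add] at h
  refine h.congr_of_eventuallyEq (Filter.Eventually.of_forall fun p => ?_)
  simp

/-- The directional derivatives of `exampleMap` away from the origin. -/
theorem fderiv_exampleMap_apply {p : ℝ × ℝ} (hp : p.1 ^ 2 + p.2 ^ 2 ≠ 0) (v : ℝ × ℝ) :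
    fderiv ℝ exampleMap p v =
      (8 * v.1 + 3 * p.1 ^ 2 * v.1 * Real.cos (1 / (p.1 ^ 2 + p.2 ^ 2)) +
          p.1 ^ 3 * Real.sin (1 / (p.1 ^ 2 + p.2 ^ 2)) *
            ((2 * p.1 * v.1 + 2 * p.2 * v.2) / (p.1 ^ 2 + p.2 ^ 2) ^ 2),
        8 * v.2 + 3 * p.2 ^ 2 * v.2 * Real.sin (1 / (p.1 ^ 2 + p.2 ^ 2)) -
          p.2 ^ 3 * Real.cos (1 / (p.1 ^ 2 + p.2 ^ 2)) *
            ((2 * p.1 * v.1 + 2 * p.2 * v.2) / (p.1 ^ 2 + p.2 ^ 2) ^ 2)) := by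
  have h1 : HasFDerivAt (fun q : ℝ × ℝ => q.1) (ContinuousLinearMap.fst ℝ ℝ ℝ) p := hasFDerivAt_fst
  have h2 : HasFDerivAt (fun q : ℝ × ℝ => q.2) (ContinuousLinearMap.snd ℝ ℝ ℝ) p := hasFDerivAt_snd
  have hr := (hasDerivAt_inv hp).comp_hasFDerivAt p ((h1.pow 2).add (h2.pow 2))
  have hG := ((h1.const_mul 8).add ((h1.pow 3).mul hr.cos)).prodMk
    ((h2.const_mul 8).add ((h2.pow 3).mul hr.sin))
  have hF := hG.congr_of_eventuallyEq (f₁ := exampleMap)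
    (Filter.Eventually.of_forall fun q => by simp [exampleMap_apply])
  rw [hF.fderiv]
  ext
  · simp
    ring
  · simp
    ring

/-- On the closed unit disc `x² + y² ≤ 1`, both leading principal minors of the Jacobian
matrix `JF(x,y)` of the example map are nonzero: `|∂F₁/∂x(x,y)| ≥ 3` and
`|det JF(x,y)| ≥ 5`. -/
theorem exampleMap_leading_principal_minors_bounds :
    ∀ p : ℝ × ℝ, p.1 ^ 2 + p.2 ^ 2 ≤ 1 →
      3 ≤ |(fderiv ℝ exampleMap p (1, 0)).1| ∧
      5 ≤ |(!![(fderiv ℝ exampleMap p (1, 0)).1, (fderiv ℝ exampleMap p (0, 1)).1;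
               (fderiv ℝ exampleMap p (1, 0)).2, (fderiv ℝ exampleMap p (0, 1)).2]).det| := by
  intro p hp
  by_cases h0 : p.1 ^ 2 + p.2 ^ 2 = 0
  · have hp0 : p = 0 := by
      ext <;> simp <;> nlinarith [sq_nonneg p.1, sq_nonneg p.2]
    rw [hp0, hasFDerivAt_exampleMap_zero.fderiv]
    norm_num [Matrix.det_fin_two]
  rw [fderiv_exampleMap_apply h0, fderiv_exampleMap_apply h0, Matrix.det_fin_two]
  obtain ⟨x, y⟩ := p
  dsimp only at hp h0 ⊢
  have hu : 0 < x ^ 2 + y ^ 2 := lt_of_le_of_ne (by positivity) (Ne.symm h0)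
  generalize 1 / (x ^ 2 + y ^ 2) = θ
  have hc := Real.abs_cos_le_one θ
  have hs := Real.abs_sin_le_one θ
  generalize Real.cos θ = c at *
  generalize Real.sin θ = s at *
  have bound : ∀ a t : ℝ, 0 ≤ a → a ≤ 1 → |t| ≤ 1 → |a * t| ≤ 1 := fun a t h h' ht => by
    rw [abs_mul, abs_of_nonneg h]
    exact mul_le_one₀ h' (abs_nonneg t) ht
  have hx := abs_le.1 (bound (x ^ 2) c (by positivity) (by nlinarith [sq_nonneg y]) hc)
  have hy := abs_le.1 (bound (y ^ 2) s (by positivity) (by nlinarith [sq_nonneg x]) hs)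
  have hx4 := bound (x ^ 4 / (x ^ 2 + y ^ 2) ^ 2) s (by positivity)
    (by rw [div_le_one (by positivity)]; nlinarith [sq_nonneg (x * y), sq_nonneg (y ^ 2)]) hs
  have hy4 := bound (y ^ 4 / (x ^ 2 + y ^ 2) ^ 2) c (by positivity)
    (by rw [div_le_one (by positivity)]; nlinarith [sq_nonneg (x * y), sq_nonneg (x ^ 2)]) hc
  have hxy : |x ^ 4 / (x ^ 2 + y ^ 2) ^ 2 * s * (y ^ 4 / (x ^ 2 + y ^ 2) ^ 2 * c)| ≤ 1 := by
    rw [abs_mul]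
    exact mul_le_one₀ hx4 (abs_nonneg _) hy4
  have hA : 3 ≤ 8 + 3 * (x ^ 2 * c) + 2 * (x ^ 4 / (x ^ 2 + y ^ 2) ^ 2 * s) := by
    linarith [(abs_le.1 hx4).1]
  have hB : 3 ≤ 8 + 3 * (y ^ 2 * s) - 2 * (y ^ 4 / (x ^ 2 + y ^ 2) ^ 2 * c) := by
    linarith [(abs_le.1 hy4).2]
  constructor
  · refine le_abs.2 (Or.inl (hA.trans_eq ?_))
    ring
  · have hdet := (abs_le.1 hxy).1
    have hAB := mul_le_mul hA hB (by norm_num) (by linarith)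
    refine le_abs.2 (Or.inl ?_)
    simp only [Matrix.of_apply, Matrix.cons_val', Matrix.cons_val_zero, Matrix.cons_val_one,
      Matrix.cons_val_fin_one]
    calc (5 : ℝ) ≤ (8 + 3 * (x ^ 2 * c) + 2 * (x ^ 4 / (x ^ 2 + y ^ 2) ^ 2 * s)) *
            (8 + 3 * (y ^ 2 * s) - 2 * (y ^ 4 / (x ^ 2 + y ^ 2) ^ 2 * c)) +
          4 * (x ^ 4 / (x ^ 2 + y ^ 2) ^ 2 * s * (y ^ 4 / (x ^ 2 + y ^ 2) ^ 2 * c)) := by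
          linarith
      _ = _ := by ring
end

section
/- Define F : ℝ² → ℝ² by F(x,y) = (8x + x³ cos(1/(x²+y²)), 8y + y³ sin(1/(x²+y²))) for (x,y) ≠ (0,0) and F(0,0) = (0,0). Then F is injective on the open unit disc centered at the origin, and there exist open sets X and Y in ℝ², each containing the origin, and a differentiable map G : Y → X with F(G(y)) = y for all y ∈ Y and G(F(x)) = x for all x ∈ X. -/
/-- A cubic factor damps the oscillation of `φ (1 / (x² + y²))` at the origin enough to keep the
derivative bounded by `7` on the unit disc. -/
lemma exists_hasFDerivAt_cube_mul_comp_norm_le {φ φ' : ℝ → ℝ} (hφ : ∀ t, HasDerivAt φ (φ' t) t)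
    (hb : ∀ t, |φ t| ≤ 1) (hb' : ∀ t, |φ' t| ≤ 1) (p : ℝ × ℝ) (hp : p.1 ^ 2 + p.2 ^ 2 < 1) :
    ∃ A : ℝ × ℝ →L[ℝ] ℝ,
      HasFDerivAt (fun q : ℝ × ℝ => q.1 ^ 3 * φ (1 / (q.1 ^ 2 + q.2 ^ 2))) A p ∧ ‖A‖ ≤ 7 := by
  by_cases h0 : p = 0
  · subst h0
    refine ⟨0, ?_, by simp⟩
    refine Asymptotics.IsBigO.hasFDerivAt (n := 3) (Asymptotics.IsBigO.of_bound 1 ?_) (by norm_num)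
    refine Filter.Eventually.of_forall fun q => ?_
    simp only [norm_mul, norm_pow, sub_zero, one_mul, norm_norm]
    calc ‖q.1‖ ^ 3 * ‖φ (1 / (q.1 ^ 2 + q.2 ^ 2))‖ ≤ ‖q‖ ^ 3 * 1 := by
          gcongr
          · exact norm_fst_le q
          · exact hb _
      _ = ‖q‖ ^ 3 := mul_one _
  · obtain ⟨x, y⟩ := p
    have hr : 0 < x ^ 2 + y ^ 2 := by
      rcases not_and_or.mp (fun h : x = 0 ∧ y = 0 => h0 (Prod.ext h.1 h.2)) with h | h <;>
        positivity
    set r := x ^ 2 + y ^ 2 with hrdef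
    have hx : HasFDerivAt (fun q : ℝ × ℝ => q.1) (.fst ℝ ℝ ℝ) (x, y) := hasFDerivAt_fst
    have hy : HasFDerivAt (fun q : ℝ × ℝ => q.2) (.snd ℝ ℝ ℝ) (x, y) := hasFDerivAt_snd
    have hinv : HasDerivAt (fun t : ℝ => 1 / t) (-(r ^ 2)⁻¹) r := by
      simpa only [one_div] using hasDerivAt_inv hr.ne'
    have hφr := (hφ (1 / r)).comp_hasFDerivAt (x, y)
      (hinv.comp_hasFDerivAt (x, y) ((hx.pow 2).add (hy.pow 2)))
    refine ⟨_, (hx.pow 3).mul hφr, ContinuousLinearMap.opNorm_le_bound _ (by norm_num) ?_⟩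
    rintro ⟨a, b⟩
    have ha : |a| ≤ ‖(a, b)‖ := norm_fst_le (a, b)
    have hbn : |b| ≤ ‖(a, b)‖ := norm_snd_le (a, b)
    set N := ‖(a, b)‖
    have hN : 0 ≤ N := norm_nonneg _
    have hx2 : x ^ 2 ≤ 1 := by nlinarith [sq_nonneg y]
    have h4 : |x| ^ 4 ≤ r ^ 2 := by
      rw [hrdef, ← sq_abs x, ← sq_abs y]
      nlinarith [sq_nonneg (|x| * |y|), sq_nonneg (|y| ^ 2)]
    have h31 : |x| ^ 3 * |y| ≤ r ^ 2 := by
      rw [hrdef, ← sq_abs x, ← sq_abs y]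
      nlinarith [sq_nonneg (|x| * |y|), sq_nonneg (|y| ^ 2), sq_nonneg (|x| * (|x| - |y|)),
        sq_nonneg (|x| ^ 2)]
    have e1 : |3 * x ^ 2 * φ (1 / r) * a| ≤ 3 * N := by
      rw [abs_mul, abs_mul, abs_mul, abs_of_pos (by norm_num : (0 : ℝ) < 3), abs_pow, sq_abs]
      calc 3 * x ^ 2 * |φ (1 / r)| * |a| ≤ 3 * 1 * 1 * N := by gcongr; exact hb _
        _ = 3 * N := by ring
    have e2 : |2 * (x ^ 4 / r ^ 2) * φ' (1 / r) * a| ≤ 2 * N := by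
      rw [abs_mul, abs_mul, abs_mul, abs_of_pos (by norm_num : (0 : ℝ) < 2), abs_div, abs_pow,
        abs_of_pos (by positivity : 0 < r ^ 2)]
      calc 2 * (|x| ^ 4 / r ^ 2) * |φ' (1 / r)| * |a| ≤ 2 * 1 * 1 * N := by
            gcongr
            · exact div_le_one_of_le₀ h4 (by positivity)
            · exact hb' _
        _ = 2 * N := by ring
    have e3 : |2 * (x ^ 3 * y / r ^ 2) * φ' (1 / r) * b| ≤ 2 * N := by
      rw [abs_mul, abs_mul, abs_mul, abs_of_pos (by norm_num : (0 : ℝ) < 2), abs_div, abs_mul,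
        abs_pow, abs_of_pos (by positivity : 0 < r ^ 2)]
      calc 2 * (|x| ^ 3 * |y| / r ^ 2) * |φ' (1 / r)| * |b| ≤ 2 * 1 * 1 * N := by
            gcongr
            · exact div_le_one_of_le₀ h31 (by positivity)
            · exact hb' _
        _ = 2 * N := by ring
    refine le_trans (le_of_eq (congrArg abs (?_ : _ = 3 * x ^ 2 * φ (1 / r) * a
      - 2 * (x ^ 4 / r ^ 2) * φ' (1 / r) * a - 2 * (x ^ 3 * y / r ^ 2) * φ' (1 / r) * b))) ?_
    · simp [← hrdef]
      ring
    · rw [abs_le] at *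
      constructor <;> linarith

lemma convex_openUnitDisc : Convex ℝ {p : ℝ × ℝ | p.1 ^ 2 + p.2 ^ 2 < 1} := by
  have hsq : ConvexOn ℝ Set.univ fun t : ℝ => t ^ 2 := even_two.convexOn_pow
  have h := (hsq.comp_linearMap (.fst ℝ ℝ ℝ)).add (hsq.comp_linearMap (.snd ℝ ℝ ℝ))
  simpa using h.convex_lt 1

lemma isOpen_openUnitDisc : IsOpen {p : ℝ × ℝ | p.1 ^ 2 + p.2 ^ 2 < 1} :=
  isOpen_lt (by fun_prop) continuous_const

lemma exampleMap_eq (p : ℝ × ℝ) :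
    exampleMap p = (8 : ℝ) • p + (p.1 ^ 3 * Real.cos (1 / (p.1 ^ 2 + p.2 ^ 2)),
      p.2 ^ 3 * Real.sin (1 / (p.1 ^ 2 + p.2 ^ 2))) := by
  unfold exampleMap
  split_ifs with h
  · simp [h]
  · ext <;> simp

/-- On the open unit disc `exampleMap` is differentiable with derivative within `7` of `8 • id`. -/
lemma exists_hasFDerivAt_exampleMap_norm_sub_le (p : ℝ × ℝ) (hp : p.1 ^ 2 + p.2 ^ 2 < 1) :
    ∃ A : ℝ × ℝ →L[ℝ] ℝ × ℝ,
      HasFDerivAt exampleMap A p ∧ ‖A - algebraMap ℝ (ℝ × ℝ →L[ℝ] ℝ × ℝ) 8‖ ≤ 7 := by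
  obtain ⟨A, hA, hA7⟩ := exists_hasFDerivAt_cube_mul_comp_norm_le Real.hasDerivAt_cos
    Real.abs_cos_le_one (fun t => by simpa using Real.abs_sin_le_one t) p hp
  obtain ⟨B, hB, hB7⟩ := exists_hasFDerivAt_cube_mul_comp_norm_le Real.hasDerivAt_sin
    Real.abs_sin_le_one Real.abs_cos_le_one p.swap (by simpa [add_comm] using hp)
  let e := ContinuousLinearEquiv.prodComm ℝ ℝ ℝ
  have hBe : HasFDerivAt (fun q : ℝ × ℝ => q.2 ^ 3 * Real.sin (1 / (q.1 ^ 2 + q.2 ^ 2)))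
      (B.comp (e : ℝ × ℝ →L[ℝ] ℝ × ℝ)) p := by
    have h := HasFDerivAt.comp p (f := e) hB e.hasFDerivAt
    refine h.congr_of_eventuallyEq (.of_forall fun q => ?_)
    simp [e, add_comm]
  refine ⟨algebraMap ℝ (ℝ × ℝ →L[ℝ] ℝ × ℝ) 8 + A.prod (B.comp (e : ℝ × ℝ →L[ℝ] ℝ × ℝ)), ?_, ?_⟩
  · rw [funext exampleMap_eq]
    exact (algebraMap ℝ (ℝ × ℝ →L[ℝ] ℝ × ℝ) 8).hasFDerivAt.add (hA.prodMk hBe)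
  · rw [add_sub_cancel_left, ContinuousLinearMap.opNorm_prod]
    refine max_le hA7 (ContinuousLinearMap.opNorm_le_bound _ (by norm_num) fun v => ?_)
    refine (B.le_of_opNorm_le hB7 (e v)).trans_eq ?_
    simp [e, Prod.norm_def, max_comm]

lemma norm_inv_map_algebraMap_eight :
    ‖((Units.map (algebraMap ℝ (ℝ × ℝ →L[ℝ] ℝ × ℝ)).toMonoidHom
      (Units.mk0 (8 : ℝ) (by norm_num)))⁻¹ : (ℝ × ℝ →L[ℝ] ℝ × ℝ)ˣ).val‖ = 8⁻¹ := by
  rw [← map_inv]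
  change ‖algebraMap ℝ (ℝ × ℝ →L[ℝ] ℝ × ℝ) 8⁻¹‖ = 8⁻¹
  rw [norm_algebraMap']
  norm_num

/-- The example map is injective on the open unit disc centered at the origin, and it is
invertible near the origin: there are open sets `X, Y ∋ (0,0)` and a differentiable
`G : Y → X` with `F (G y) = y` on `Y` and `G (F x) = x` on `X`. -/
theorem exampleMap_locally_invertible :
    Set.InjOn exampleMap {p : ℝ × ℝ | p.1 ^ 2 + p.2 ^ 2 < 1} ∧
    ∃ X Y : Set (ℝ × ℝ), IsOpen X ∧ IsOpen Y ∧ (0, 0) ∈ X ∧ (0, 0) ∈ Y ∧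
      ∃ G : ℝ × ℝ → ℝ × ℝ,
        (∀ y ∈ Y, G y ∈ X) ∧ (∀ y ∈ Y, DifferentiableAt ℝ G y) ∧
        (∀ y ∈ Y, exampleMap (G y) = y) ∧ ∀ x ∈ X, G (exampleMap x) = x := by
  set s := {p : ℝ × ℝ | p.1 ^ 2 + p.2 ^ 2 < 1} with hs
  let u : (ℝ × ℝ →L[ℝ] ℝ × ℝ)ˣ := Units.map (algebraMap ℝ (ℝ × ℝ →L[ℝ] ℝ × ℝ)).toMonoidHom
    (Units.mk0 (8 : ℝ) (by norm_num))
  have hu : ‖(u⁻¹).val‖ = 8⁻¹ := norm_inv_map_algebraMap_eight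
  let e := ContinuousLinearEquiv.ofUnit u
  choose! A hA hA7 using exists_hasFDerivAt_exampleMap_norm_sub_le
  have happrox : ApproximatesLinearOn exampleMap (e : ℝ × ℝ →L[ℝ] ℝ × ℝ) s 7 := by
    refine ApproximatesLinearOn.approximatesLinearOn_iff_lipschitzOnWith.2 ?_
    refine convex_openUnitDisc.lipschitzOnWith_of_nnnorm_hasFDerivWithin_le
      (fun p hp => ((hA p hp).sub (e : ℝ × ℝ →L[ℝ] ℝ × ℝ).hasFDerivAt).hasFDerivWithinAt)
      fun p hp => ?_
    exact hA7 p hp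
  have hc : Subsingleton (ℝ × ℝ) ∨ (7 : NNReal) < ‖(e.symm : ℝ × ℝ →L[ℝ] ℝ × ℝ)‖₊⁻¹ := by
    right
    have h : ‖(e.symm : ℝ × ℝ →L[ℝ] ℝ × ℝ)‖ = 8⁻¹ := hu
    rw [← NNReal.coe_lt_coe, NNReal.coe_inv, coe_nnnorm, h]
    norm_num
  let Φ := happrox.toOpenPartialHomeomorph exampleMap s hc isOpen_openUnitDisc
  have h0 : ((0, 0) : ℝ × ℝ) ∈ s := by simp [hs]
  refine ⟨happrox.injOn hc, s, Φ.target, isOpen_openUnitDisc, Φ.open_target, h0,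
    ⟨(0, 0), h0, by simp [exampleMap]⟩, Φ.symm, fun y hy => Φ.map_target hy, fun y hy => ?_,
    fun y hy => Φ.right_inv hy, fun x hx => Φ.left_inv hx⟩
  have hy' : Φ.symm y ∈ s := Φ.map_target hy
  let v := u.ofNearby (A (Φ.symm y)) (by
    refine (hA7 _ hy').trans_lt ?_
    rw [hu]
    norm_num)
  exact (Φ.hasFDerivAt_symm (f' := ContinuousLinearEquiv.ofUnit v) hy
    (hA _ hy')).differentiableAt
end
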